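/- arXiv:2105.02524 — 3 statements merged into one kernel-verified Lean document; each statement's English description precedes it below -/
import Mathlib

section
/- For all real ν ≥ 1/2, the function x ↦ x·I_ν(x)·K_ν(x) is strictly increasing on (0, ∞). -/
open Real

/-- Modified Bessel function of the first kind `I_ν(x)` (for `x > 0`),
defined by its standard power series. -/
noncomputable def besselI (ν x : ℝ) : ℝ :=
  ∑' k : ℕ, (x / 2) ^ (2 * k) / ((Nat.factorial k : ℝ) * Real.Gamma (k + ν + 1)) * (x / 2) ^ ν

/-- Modified Bessel function of the second kind `K_ν(x)` (for `x > 0`),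
defined by its standard integral representation. -/
noncomputable def besselK (ν x : ℝ) : ℝ :=
  ∫ t in Set.Ioi (0 : ℝ), Real.exp (-x * Real.cosh t) * Real.cosh (ν * t)

/-- The entire function `F_ν(y) = ∑ y^k/(k! Γ(k+ν+1))`. -/
noncomputable def bF (ν y : ℝ) : ℝ :=
  ∑' k : ℕ, y ^ k / ((Nat.factorial k : ℝ) * Real.Gamma (k + ν + 1))

lemma bGamma_lb (ν : ℝ) (hν : 0 ≤ ν) (k : ℕ) :
    Real.Gamma (ν + 1) ≤ Real.Gamma (k + ν + 1) := by
  induction k with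
  | zero => simp
  | succ k ih =>
    have h1 : ((k + 1 : ℕ) : ℝ) + ν + 1 = (k + ν + 1) + 1 := by push_cast; ring
    have hp : (0 : ℝ) < k + ν + 1 := by positivity
    rw [h1, Real.Gamma_add_one hp.ne']
    have := Real.Gamma_pos_of_pos hp
    have hk : (0 : ℝ) ≤ k := Nat.cast_nonneg k
    nlinarith

lemma bGamma_pos (ν : ℝ) (hν : 0 ≤ ν) (k : ℕ) : 0 < Real.Gamma (k + ν + 1) :=
  Real.Gamma_pos_of_pos (by positivity)

lemma bF_summable (ν : ℝ) (hν : 0 ≤ ν) (y : ℝ) :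
    Summable fun k : ℕ => y ^ k / ((Nat.factorial k : ℝ) * Real.Gamma (k + ν + 1)) := by
  have h0 : 0 < Real.Gamma (ν + 1) := Real.Gamma_pos_of_pos (by linarith)
  refine Summable.of_norm_bounded
    (((Real.summable_pow_div_factorial |y|)).mul_right (Real.Gamma (ν + 1))⁻¹) ?_
  intro k
  have h1 := bGamma_pos ν hν k
  have h2 := bGamma_lb ν hν k
  have hf : (0 : ℝ) < Nat.factorial k := by positivity
  rw [Real.norm_eq_abs, abs_div, abs_pow, abs_of_pos (mul_pos hf h1), ← div_eq_mul_inv, div_div]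
  gcongr

lemma bF_pos (ν : ℝ) (hν : 0 ≤ ν) (y : ℝ) (hy : 0 < y) : 0 < bF ν y := by
  refine (bF_summable ν hν y).tsum_pos (fun k => ?_) 0 ?_
  · have h1 := bGamma_pos ν hν k
    positivity
  · have h1 := bGamma_pos ν hν 0
    positivity

lemma bTerm_shift (ν y : ℝ) (k : ℕ) :
    ((k + 1 : ℕ) : ℝ) * y ^ (k + 1 - 1) /
      ((Nat.factorial (k + 1) : ℝ) * Real.Gamma ((k + 1 : ℕ) + ν + 1))
    = y ^ k / ((Nat.factorial k : ℝ) * Real.Gamma (k + (ν + 1) + 1)) := by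
  have h1 : ((k + 1 : ℕ) : ℝ) + ν + 1 = k + (ν + 1) + 1 := by push_cast; ring
  rw [h1, Nat.factorial_succ]
  have : ((k + 1 : ℕ) : ℝ) ≠ 0 := by positivity
  rw [Nat.cast_mul, mul_assoc, mul_div_mul_left _ _ this]
  simp

lemma bF_hasDerivAt (ν : ℝ) (hν : 0 ≤ ν) (y : ℝ) : HasDerivAt (bF ν) (bF (ν + 1) y) y := by
  have hsum : ∀ z : ℝ, Summable fun k : ℕ => (k : ℝ) * z ^ (k - 1) /
      ((Nat.factorial k : ℝ) * Real.Gamma (k + ν + 1)) := by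
    intro z
    rw [← summable_nat_add_iff 1]
    refine (bF_summable (ν + 1) (by linarith) z).congr ?_
    intro k
    exact (bTerm_shift ν z k).symm
  have key := hasDerivAt_tsum_of_isPreconnected
    (g := fun (k : ℕ) (z : ℝ) => z ^ k / ((Nat.factorial k : ℝ) * Real.Gamma (k + ν + 1)))
    (g' := fun (k : ℕ) (z : ℝ) => (k : ℝ) * z ^ (k - 1) /
      ((Nat.factorial k : ℝ) * Real.Gamma (k + ν + 1)))
    (t := Metric.ball (0 : ℝ) (|y| + 1)) (y₀ := 0) (y := y)
    (hsum (|y| + 1)) Metric.isOpen_ball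
    (convex_ball (0 : ℝ) (|y| + 1)).isPreconnected
    (fun k z _ => (hasDerivAt_pow k z).div_const _)
    (fun k z hz => by
      have h1 := bGamma_pos ν hν k
      have hf : (0 : ℝ) < Nat.factorial k := by positivity
      have hz' : |z| ≤ |y| + 1 := by
        simpa using (Metric.mem_ball.1 hz).le
      rw [Real.norm_eq_abs, abs_div, abs_mul, abs_pow, abs_of_pos (mul_pos hf h1), Nat.abs_cast]
      gcongr)
    (Metric.mem_ball_self (by positivity)) (bF_summable ν hν 0)
    (by simp)
  have heq : bF (ν + 1) y = ∑' k : ℕ, (k : ℝ) * y ^ (k - 1) /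
      ((Nat.factorial k : ℝ) * Real.Gamma (k + ν + 1)) := by
    rw [(hsum y).tsum_eq_zero_add]
    simp only [Nat.cast_zero, zero_mul, zero_div, zero_add]
    exact tsum_congr fun k => (bTerm_shift ν y k).symm
  rw [heq]
  exact key

lemma bF_rec (ν : ℝ) (hν : 0 ≤ ν) (y : ℝ) :
    bF ν y = y * bF (ν + 2) y + (ν + 1) * bF (ν + 1) y := by
  have s0 := bF_summable ν hν y
  have s1 := bF_summable (ν + 1) (by linarith) y
  have s2 := bF_summable (ν + 2) (by linarith) y
  have e2 : y * bF (ν + 2) y = ∑' k : ℕ, (k : ℝ) * (y ^ k /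
      ((Nat.factorial k : ℝ) * Real.Gamma (k + (ν + 1) + 1))) := by
    have hsh : ∀ k : ℕ, ((k + 1 : ℕ) : ℝ) * (y ^ (k + 1) /
      ((Nat.factorial (k + 1) : ℝ) * Real.Gamma ((k + 1 : ℕ) + (ν + 1) + 1))) =
      y * (y ^ k / ((Nat.factorial k : ℝ) * Real.Gamma (k + (ν + 2) + 1))) := by
      intro k
      have := bTerm_shift (ν + 1) y k
      rw [show ν + 1 + 1 = ν + 2 by ring] at this
      rw [← this, Nat.add_sub_cancel, pow_succ]
      ring
    have hs : Summable fun k : ℕ => (k : ℝ) * (y ^ k /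
      ((Nat.factorial k : ℝ) * Real.Gamma (k + (ν + 1) + 1))) := by
      rw [← summable_nat_add_iff 1]
      exact (s2.mul_left y).congr fun k => (hsh k).symm
    rw [hs.tsum_eq_zero_add]
    simp only [Nat.cast_zero, zero_mul, zero_add]
    rw [bF, ← tsum_mul_left]
    exact tsum_congr fun k => (hsh k).symm
  have hs : Summable fun k : ℕ => (k : ℝ) * (y ^ k /
      ((Nat.factorial k : ℝ) * Real.Gamma (k + (ν + 1) + 1))) := by
    refine (s0.sub (s1.mul_left (ν + 1))).congr ?_
    intro k
    have hp : (0 : ℝ) < k + ν + 1 := by positivity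
    have hg := bGamma_pos ν hν k
    have hf : (0 : ℝ) < Nat.factorial k := by positivity
    rw [show (k : ℝ) + (ν + 1) + 1 = (k + ν + 1) + 1 by ring, Real.Gamma_add_one hp.ne']
    field_simp
    ring
  rw [e2, bF, bF, ← tsum_mul_left, ← hs.tsum_add (s1.mul_left (ν + 1))]
  refine tsum_congr fun k => ?_
  have hp : (0 : ℝ) < k + ν + 1 := by positivity
  have hg := bGamma_pos ν hν k
  have hf : (0 : ℝ) < Nat.factorial k := by positivity
  rw [show (k : ℝ) + (ν + 1) + 1 = (k + ν + 1) + 1 by ring, Real.Gamma_add_one hp.ne']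
  field_simp
  ring

lemma besselI_eq (ν x : ℝ) : besselI ν x = bF ν (x ^ 2 / 4) * (x / 2) ^ ν := by
  rw [besselI, tsum_mul_right, bF]
  congr 1
  refine tsum_congr fun k => ?_
  rw [pow_mul]
  congr 2
  ring

lemma besselI_pos (ν : ℝ) (hν : 0 ≤ ν) (x : ℝ) (hx : 0 < x) : 0 < besselI ν x := by
  rw [besselI_eq]
  have := bF_pos ν hν (x ^ 2 / 4) (by positivity)
  positivity

lemma besselI_hasDerivAt (ν : ℝ) (hν : 0 ≤ ν) (x : ℝ) (hx : 0 < x) :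
    HasDerivAt (besselI ν) (besselI (ν + 1) x + ν / x * besselI ν x) x := by
  have hfun : besselI ν = fun x => bF ν (x ^ 2 / 4) * (x / 2) ^ ν := funext (besselI_eq ν)
  have h1 : HasDerivAt (fun x : ℝ => x ^ 2 / 4) (x / 2) x := by
    have := (hasDerivAt_pow 2 x).div_const 4
    refine HasDerivAt.congr_deriv this ?_
    norm_num
    ring
  have h2 : HasDerivAt (fun x : ℝ => bF ν (x ^ 2 / 4)) (bF (ν + 1) (x ^ 2 / 4) * (x / 2)) x := by
    have h := bF_hasDerivAt ν hν (x ^ 2 / 4)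
    exact HasDerivAt.comp (h₂ := bF ν) (h := fun x : ℝ => x ^ 2 / 4) x h h1
  have h3 : HasDerivAt (fun x : ℝ => (x / 2) ^ ν) (1 / 2 * ν * (x / 2) ^ (ν - 1)) x :=
    ((hasDerivAt_id x).div_const 2).rpow_const (Or.inl (by simp; positivity))
  have h4 := h2.mul h3
  rw [besselI_eq, besselI_eq, hfun]
  have hx2 : 0 < x / 2 := by positivity
  refine HasDerivAt.congr_deriv h4 ?_
  rw [Real.rpow_sub_one hx2.ne', Real.rpow_add_one hx2.ne']
  field_simp

lemma besselI_rec (ν : ℝ) (hν : 0 ≤ ν) (x : ℝ) (hx : 0 < x) :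
    besselI ν x = besselI (ν + 2) x + 2 * (ν + 1) / x * besselI (ν + 1) x := by
  have hx2 : 0 < x / 2 := by positivity
  rw [besselI_eq, besselI_eq, besselI_eq, bF_rec ν hν, show ν + 2 = ν + 1 + 1 by ring,
    Real.rpow_add_one hx2.ne', Real.rpow_add_one hx2.ne']
  field_simp
  ring

lemma besselI_hasDerivAt2 (ν : ℝ) (hν : 0 ≤ ν) (x : ℝ) (hx : 0 < x) :
    HasDerivAt (fun x => besselI (ν + 1) x + ν / x * besselI ν x)
      ((1 + ν ^ 2 / x ^ 2) * besselI ν x -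
        (besselI (ν + 1) x + ν / x * besselI ν x) / x) x := by
  have h1 := besselI_hasDerivAt (ν + 1) (by linarith) x hx
  have h2 := besselI_hasDerivAt ν hν x hx
  have h3 : HasDerivAt (fun x : ℝ => ν / x) (-ν / x ^ 2) x := by
    have := (hasDerivAt_inv hx.ne').const_mul ν
    refine HasDerivAt.congr_deriv this ?_
    field_simp
  have h4 := h1.add (h3.mul h2)
  refine HasDerivAt.congr_deriv h4 ?_
  have := besselI_rec ν hν x hx
  have e : besselI (ν + 1 + 1) x = besselI ν x - 2 * (ν + 1) / x * besselI (ν + 1) x := by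
    rw [show ν + 1 + 1 = ν + 2 by ring]; linarith
  rw [e]
  field_simp
  ring

/-! Energy -/

lemma energy_mono (ν : ℝ) (hν : 1 / 2 ≤ ν) (f g : ℝ → ℝ)
    (hf : ∀ x, 0 < x → HasDerivAt f (g x) x)
    (hg : ∀ x, 0 < x → HasDerivAt g ((1 + ν ^ 2 / x ^ 2) * f x - g x / x) x) :
    MonotoneOn (fun x => x * g x ^ 2 + f x * g x - x * f x ^ 2 - (ν ^ 2 - 1 / 2) * (f x ^ 2 / x))
      (Set.Ioi 0) := by
  have hd : ∀ x, 0 < x → HasDerivAt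
      (fun x => x * g x ^ 2 + f x * g x - x * f x ^ 2 - (ν ^ 2 - 1 / 2) * (f x ^ 2 / x))
      (2 * (ν ^ 2 - 1 / 4) * f x ^ 2 / x ^ 2) x := by
    intro x hx
    have a := hf x hx
    have b := hg x hx
    have i := hasDerivAt_id x
    have := (((i.mul (b.pow 2)).add (a.mul b)).sub (i.mul (a.pow 2))).sub
      (((a.pow 2).div i hx.ne').const_mul (ν ^ 2 - 1 / 2))
    refine HasDerivAt.congr_deriv this ?_
    simp
    field_simp
    ring
  refine monotoneOn_of_hasDerivWithinAt_nonneg (convex_Ioi 0)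
    (fun x hx => (hd x hx).continuousAt.continuousWithinAt)
    (f' := fun x => 2 * (ν ^ 2 - 1 / 4) * f x ^ 2 / x ^ 2)
    (fun x hx => (hd x (by simpa using hx)).hasDerivWithinAt) ?_
  intro x hx
  have : 0 ≤ ν ^ 2 - 1 / 4 := by nlinarith
  positivity

/-! Bessel K -/

open MeasureTheory Filter Topology

/-- moments -/
noncomputable def bM (ν : ℝ) (n : ℕ) (x : ℝ) : ℝ :=
  ∫ t in Set.Ioi (0 : ℝ), Real.cosh t ^ n * (Real.exp (-x * Real.cosh t) * Real.cosh (ν * t))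

lemma cosh_le_exp' (t : ℝ) (ht : 0 ≤ t) : Real.cosh t ≤ Real.exp t := by
  rw [Real.cosh_eq]
  have : Real.exp (-t) ≤ Real.exp t := Real.exp_le_exp.2 (by linarith)
  linarith

lemma cosh_lb (t : ℝ) (ht : 0 ≤ t) : t ^ 2 / 2 ≤ Real.cosh t := by
  have h1 : t / 2 ≤ Real.sinh (t / 2) := Real.self_le_sinh_iff.2 (by linarith)
  have h2 := Real.cosh_two_mul (t / 2)
  have h3 := Real.cosh_sq (t / 2)
  rw [mul_div_cancel₀ t two_ne_zero] at h2
  nlinarith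

lemma bK_bound (ν : ℝ) (hν : 0 ≤ ν) (n : ℕ) (x : ℝ) (hx : 0 < x) (t : ℝ) (ht : 0 ≤ t) :
    Real.exp t ^ n * (Real.exp (-x * Real.cosh t) * Real.exp (ν * t)) ≤
      Real.exp ((n + ν) ^ 2 / x) * Real.exp (-(x / 4) * t ^ 2) := by
  rw [← Real.exp_nat_mul, ← Real.exp_add, ← Real.exp_add, ← Real.exp_add]
  apply Real.exp_le_exp.2
  have h1 := cosh_lb t ht
  have h2 : x * (t ^ 2 / 2) ≤ x * Real.cosh t := by gcongr
  have h3 : (n + ν) * t ≤ (n + ν) ^ 2 / x + x / 4 * t ^ 2 := by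
    have : (n + ν) ^ 2 / x + x / 4 * t ^ 2 - (n + ν) * t = ((n + ν) - x / 2 * t) ^ 2 / x := by
      field_simp
      ring
    have h5 : 0 ≤ ((n + ν) - x / 2 * t) ^ 2 / x := by positivity
    linarith
  nlinarith

lemma bM_term_le (ν : ℝ) (hν : 0 ≤ ν) (n : ℕ) (x : ℝ) (hx : 0 < x) (t : ℝ) (ht : 0 ≤ t) :
    Real.cosh t ^ n * (Real.exp (-x * Real.cosh t) * Real.cosh (ν * t)) ≤
      Real.exp ((n + ν) ^ 2 / x) * Real.exp (-(x / 4) * t ^ 2) := by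
  refine le_trans ?_ (bK_bound ν hν n x hx t ht)
  have := cosh_le_exp' t ht
  have := cosh_le_exp' (ν * t) (by positivity)
  have := Real.cosh_pos t
  gcongr

lemma bM_integrable (ν : ℝ) (hν : 0 ≤ ν) (n : ℕ) (x : ℝ) (hx : 0 < x) :
    IntegrableOn (fun t => Real.cosh t ^ n * (Real.exp (-x * Real.cosh t) * Real.cosh (ν * t)))
      (Set.Ioi 0) := by
  refine Integrable.mono'
    (((integrable_exp_neg_mul_sq (b := x / 4) (by positivity)).const_mul
      (Real.exp ((n + ν) ^ 2 / x))).integrableOn) ?_ ?_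
  · exact Continuous.aestronglyMeasurable (by fun_prop)
  · refine (ae_restrict_iff' measurableSet_Ioi).2 (Eventually.of_forall fun t ht => ?_)
    have h1 := Real.cosh_pos t
    have h2 := Real.cosh_pos (ν * t)
    rw [Real.norm_eq_abs, abs_of_nonneg (by positivity)]
    exact bM_term_le ν hν n x hx t (le_of_lt ht)

lemma bM_hasDerivAt (ν : ℝ) (hν : 0 ≤ ν) (n : ℕ) (x : ℝ) (hx : 0 < x) :
    HasDerivAt (bM ν n) (-bM ν (n + 1) x) x := by
  have key := hasDerivAt_integral_of_dominated_loc_of_deriv_le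
    (μ := volume.restrict (Set.Ioi (0 : ℝ))) (s := Set.Ioi (x / 2)) (x₀ := x)
    (F := fun x t => Real.cosh t ^ n * (Real.exp (-x * Real.cosh t) * Real.cosh (ν * t)))
    (F' := fun x t => -(Real.cosh t ^ (n + 1) *
      (Real.exp (-x * Real.cosh t) * Real.cosh (ν * t))))
    (bound := fun t => Real.cosh t ^ (n + 1) *
      (Real.exp (-(x / 2) * Real.cosh t) * Real.cosh (ν * t)))
    (Ioi_mem_nhds (by linarith))
    (Eventually.of_forall fun z => Continuous.aestronglyMeasurable (by fun_prop))
    (bM_integrable ν hν n x hx)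
    (Continuous.aestronglyMeasurable (by fun_prop))
    (Eventually.of_forall fun t z hz => by
      have h1 := Real.cosh_pos t
      have h2 := Real.cosh_pos (ν * t)
      rw [norm_neg, Real.norm_eq_abs, abs_of_nonneg (by positivity)]
      have hz' : x / 2 ≤ z := le_of_lt hz
      gcongr)
    (bM_integrable ν hν (n + 1) (x / 2) (by positivity))
    (Eventually.of_forall fun t z _ => by
      have h1 : HasDerivAt (fun z : ℝ => -z * Real.cosh t) (-1 * Real.cosh t) z :=
        (hasDerivAt_id z).neg.mul_const _
      have h2 := ((h1.exp).mul_const (Real.cosh (ν * t))).const_mul (Real.cosh t ^ n)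
      refine HasDerivAt.congr_deriv h2 ?_
      ring)
  have h := key.2
  rw [integral_neg] at h
  exact h

lemma bM_zero (ν : ℝ) : besselK ν = bM ν 0 := by
  funext x
  simp [besselK, bM]

lemma bM_pos (ν : ℝ) (hν : 0 ≤ ν) (n : ℕ) (x : ℝ) (hx : 0 < x) : 0 < bM ν n x := by
  have hp : ∀ t, 0 < Real.cosh t ^ n * (Real.exp (-x * Real.cosh t) * Real.cosh (ν * t)) := by
    intro t
    have h1 := Real.cosh_pos t
    have h2 := Real.cosh_pos (ν * t)
    positivity
  rw [bM, setIntegral_pos_iff_support_of_nonneg_ae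
    (Eventually.of_forall fun t => (hp t).le) (bM_integrable ν hν n x hx)]
  have : Function.support (fun t => Real.cosh t ^ n *
      (Real.exp (-x * Real.cosh t) * Real.cosh (ν * t))) = Set.univ := by
    ext t
    simpa using (hp t).ne'
  rw [this]
  simp

lemma bM_decay (ν : ℝ) (hν : 0 ≤ ν) (n : ℕ) (x : ℝ) (hx : 1 ≤ x) :
    bM ν n x ≤ Real.exp (1 - x) * bM ν n 1 := by
  rw [bM, bM, ← integral_const_mul]
  refine setIntegral_mono (bM_integrable ν hν n x (by linarith))
    ((bM_integrable ν hν n 1 one_pos).const_mul _) ?_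
  intro t
  have h1 := Real.cosh_pos t
  have h2 := Real.cosh_pos (ν * t)
  have h3 : Real.exp (-x * Real.cosh t) ≤ Real.exp (1 - x) * Real.exp (-1 * Real.cosh t) := by
    rw [← Real.exp_add]
    apply Real.exp_le_exp.2
    nlinarith [Real.one_le_cosh t]
  calc Real.cosh t ^ n * (Real.exp (-x * Real.cosh t) * Real.cosh (ν * t))
      ≤ Real.cosh t ^ n * (Real.exp (1 - x) * Real.exp (-1 * Real.cosh t)
        * Real.cosh (ν * t)) := by gcongr
    _ = _ := by ring

lemma bM_ode (ν : ℝ) (hν : 0 ≤ ν) (x : ℝ) (hx : 0 < x) :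
    x ^ 2 * bM ν 2 x - x * bM ν 1 x - (x ^ 2 + ν ^ 2) * bM ν 0 x = 0 := by
  let G : ℝ → ℝ := fun t => Real.exp (-x * Real.cosh t) *
    (-x * Real.sinh t * Real.cosh (ν * t) - ν * Real.sinh (ν * t))
  let E : ℕ → ℝ → ℝ := fun n t =>
    Real.cosh t ^ n * (Real.exp (-x * Real.cosh t) * Real.cosh (ν * t))
  let G' : ℝ → ℝ := fun t => x ^ 2 * E 2 t - x * E 1 t - (x ^ 2 + ν ^ 2) * E 0 t
  have i0 : IntegrableOn (E 0) (Set.Ioi 0) := bM_integrable ν hν 0 x hx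
  have i1 : IntegrableOn (E 1) (Set.Ioi 0) := bM_integrable ν hν 1 x hx
  have i2 : IntegrableOn (E 2) (Set.Ioi 0) := bM_integrable ν hν 2 x hx
  have hderiv : ∀ t ∈ Set.Ici (0 : ℝ), HasDerivAt G (G' t) t := by
    intro t _
    have hν' : HasDerivAt (fun t : ℝ => ν * t) (ν * 1) t := (hasDerivAt_id t).const_mul ν
    have h1 := ((Real.hasDerivAt_cosh t).const_mul (-x)).exp
    have h2 := (((Real.hasDerivAt_sinh t).const_mul (-x)).mul hν'.cosh).sub (hν'.sinh.const_mul ν)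
    have h3 := h1.mul h2
    refine HasDerivAt.congr_deriv h3 ?_
    simp only [G', E]
    have hs : Real.cosh t ^ 2 = Real.sinh t ^ 2 + 1 := Real.cosh_sq t
    simp only [pow_zero, pow_one, hs]
    simp
    ring
  have hint : IntegrableOn G' (Set.Ioi 0) :=
    ((i2.const_mul _).sub (i1.const_mul _)).sub (i0.const_mul _)
  have hlim : Tendsto G atTop (𝓝 0) := by
    have hb : Tendsto (fun t : ℝ => (x + ν) * (Real.exp (((1 : ℕ) + ν) ^ 2 / x) *
        Real.exp (-(x / 4) * t ^ 2))) atTop (𝓝 0) := by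
      have h1 : Tendsto (fun t : ℝ => Real.exp (-(x / 4) * t ^ 2)) atTop (𝓝 0) := by
        apply Real.tendsto_exp_atBot.comp
        exact (tendsto_pow_atTop (two_ne_zero)).const_mul_atTop_of_neg (by linarith)
      simpa using (h1.const_mul (Real.exp (((1 : ℕ) + ν) ^ 2 / x))).const_mul (x + ν)
    refine squeeze_zero_norm' ?_ hb
    filter_upwards [eventually_ge_atTop (0 : ℝ)] with t ht
    have hbd := bK_bound ν hν 1 x hx t ht
    have hνt : 0 ≤ ν * t := by positivity
    have c1 := cosh_le_exp' t ht
    have c2 := cosh_le_exp' (ν * t) hνt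
    have s1 : Real.sinh t ≤ Real.exp t := (Real.sinh_lt_cosh t).le.trans c1
    have s2 : Real.sinh (ν * t) ≤ Real.exp (ν * t) := (Real.sinh_lt_cosh _).le.trans c2
    have p1 : 0 ≤ Real.sinh t := Real.sinh_nonneg_iff.2 ht
    have p2 : 0 ≤ Real.sinh (ν * t) := Real.sinh_nonneg_iff.2 hνt
    have p3 := Real.cosh_pos (ν * t)
    have e1 : 1 ≤ Real.exp t := Real.one_le_exp ht
    have hG : ‖G t‖ = Real.exp (-x * Real.cosh t) *
      (x * Real.sinh t * Real.cosh (ν * t) + ν * Real.sinh (ν * t)) := by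
      have : G t = -(Real.exp (-x * Real.cosh t) *
        (x * Real.sinh t * Real.cosh (ν * t) + ν * Real.sinh (ν * t))) := by
        simp only [G]; ring
      rw [this, norm_neg, Real.norm_eq_abs, abs_of_nonneg (by positivity)]
    rw [hG]
    calc _ ≤ Real.exp (-x * Real.cosh t) *
        (x * Real.exp t * Real.exp (ν * t) + ν * (Real.exp t * Real.exp (ν * t))) := by
          have : Real.sinh (ν * t) ≤ Real.exp t * Real.exp (ν * t) :=
            s2.trans (le_mul_of_one_le_left (Real.exp_pos _).le e1)
          gcongr
      _ = (x + ν) * (Real.exp t ^ 1 * (Real.exp (-x * Real.cosh t) * Real.exp (ν * t))) := by ring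
      _ ≤ _ := by gcongr
  have h := integral_Ioi_of_hasDerivAt_of_tendsto' hderiv hint hlim
  have hG0 : G 0 = 0 := by simp [G]
  rw [hG0, sub_zero] at h
  rw [← h]
  have a2 : ∫ t in Set.Ioi (0:ℝ), G' t = (∫ t in Set.Ioi (0:ℝ), (x ^ 2 * E 2 t - x * E 1 t))
      - ∫ t in Set.Ioi (0:ℝ), (x ^ 2 + ν ^ 2) * E 0 t :=
    integral_sub ((i2.const_mul _).sub (i1.const_mul _)) (i0.const_mul _)
  rw [a2, integral_sub (i2.const_mul _) (i1.const_mul _), integral_const_mul, integral_const_mul,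
    integral_const_mul]
  rfl

lemma K_energy_nonpos (ν : ℝ) (hν : 1 / 2 ≤ ν) (x : ℝ) (hx : 0 < x) :
    x * (-bM ν 1 x) ^ 2 + bM ν 0 x * (-bM ν 1 x) - x * bM ν 0 x ^ 2
      - (ν ^ 2 - 1 / 2) * (bM ν 0 x ^ 2 / x) ≤ 0 := by
  have hν0 : 0 ≤ ν := by linarith
  have hmono := energy_mono ν hν (bM ν 0) (fun x => -bM ν 1 x)
    (fun x hx => bM_hasDerivAt ν hν0 0 x hx)
    (fun x hx => by
      have h := (bM_hasDerivAt ν hν0 1 x hx).neg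
      refine HasDerivAt.congr_deriv h ?_
      have := bM_ode ν hν0 x hx
      have e : bM ν 2 x = (x * bM ν 1 x + (x ^ 2 + ν ^ 2) * bM ν 0 x) / x ^ 2 := by
        field_simp
        linarith
      simp only [Nat.reduceAdd, neg_neg]
      rw [e]
      field_simp
      ring)
  -- upper bound tending to zero
  set C := bM ν 1 1 ^ 2 + bM ν 0 1 ^ 2 with hC
  have hlim : Tendsto (fun y : ℝ => C * (Real.exp 1 ^ 2 * (y ^ 1 * Real.exp (-y)))) atTop (𝓝 0) := by
    have h := ((Real.tendsto_pow_mul_exp_neg_atTop_nhds_zero 1).const_mul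
      (Real.exp 1 ^ 2)).const_mul C
    rwa [mul_zero, mul_zero] at h
  refine ge_of_tendsto hlim ?_
  filter_upwards [eventually_ge_atTop (max x 1)] with y hy
  have hyx : x ≤ y := le_trans (le_max_left _ _) hy
  have hy1 : 1 ≤ y := le_trans (le_max_right _ _) hy
  have hy0 : 0 < y := by linarith
  refine (hmono (Set.mem_Ioi.2 hx) (Set.mem_Ioi.2 hy0) hyx).trans ?_
  have d0 := bM_decay ν hν0 0 y hy1
  have d1 := bM_decay ν hν0 1 y hy1
  have p0 := bM_pos ν hν0 0 y hy0
  have p1 := bM_pos ν hν0 1 y hy0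
  have q0 := bM_pos ν hν0 0 1 one_pos
  have q1 := bM_pos ν hν0 1 1 one_pos
  have hsq1 : bM ν 1 y ^ 2 ≤ (Real.exp (1 - y) * bM ν 1 1) ^ 2 := by gcongr
  have hsq0 : bM ν 0 y ^ 2 ≤ (Real.exp (1 - y) * bM ν 0 1) ^ 2 := by gcongr
  have hee : Real.exp (1 - y) ^ 2 ≤ Real.exp 1 ^ 2 * Real.exp (-y) := by
    rw [← Real.exp_nat_mul, ← Real.exp_nat_mul, ← Real.exp_add]
    apply Real.exp_le_exp.2
    push_cast
    linarith
  have hdiv : bM ν 0 y ^ 2 / y ≤ y * bM ν 0 y ^ 2 := by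
    rw [div_le_iff₀ hy0]
    have : 1 ≤ y * y := by nlinarith
    nlinarith [sq_nonneg (bM ν 0 y)]
  have hdiv0 : 0 ≤ bM ν 0 y ^ 2 / y := by positivity
  have hν2 : 0 ≤ ν ^ 2 - 1 / 4 := by nlinarith
  have b1 : y * (-bM ν 1 y) ^ 2 + bM ν 0 y * (-bM ν 1 y) - y * bM ν 0 y ^ 2
      - (ν ^ 2 - 1 / 2) * (bM ν 0 y ^ 2 / y) ≤ y * (bM ν 1 y ^ 2 + bM ν 0 y ^ 2) := by
    have := mul_pos p0 p1
    have := mul_nonneg hν2 hdiv0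
    have : 0 ≤ y * bM ν 0 y ^ 2 := by positivity
    nlinarith
  refine b1.trans ?_
  calc y * (bM ν 1 y ^ 2 + bM ν 0 y ^ 2)
      ≤ y * ((Real.exp (1 - y) * bM ν 1 1) ^ 2 + (Real.exp (1 - y) * bM ν 0 1) ^ 2) := by gcongr
    _ = y * C * Real.exp (1 - y) ^ 2 := by rw [hC]; ring
    _ ≤ y * C * (Real.exp 1 ^ 2 * Real.exp (-y)) := by
      have : 0 ≤ y * C := by positivity
      gcongr
    _ = _ := by ring

lemma I_energy_pos (ν : ℝ) (hν : 1 / 2 ≤ ν) (x : ℝ) (hx : 0 < x) :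
    0 < x * (besselI (ν + 1) x + ν / x * besselI ν x) ^ 2
      + besselI ν x * (besselI (ν + 1) x + ν / x * besselI ν x) - x * besselI ν x ^ 2
      - (ν ^ 2 - 1 / 2) * (besselI ν x ^ 2 / x) := by
  have hν0 : 0 ≤ ν := by linarith
  have hmono := energy_mono ν hν (besselI ν) (fun x => besselI (ν + 1) x + ν / x * besselI ν x)
    (besselI_hasDerivAt ν hν0) (besselI_hasDerivAt2 ν hν0)
  set y := min x (1 / 2) with hy
  have hy0 : 0 < y := by positivity
  have hyx : y ≤ x := min_le_left _ _
  have hy2 : y ≤ 1 / 2 := min_le_right _ _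
  have hle := hmono (Set.mem_Ioi.2 hy0) (Set.mem_Ioi.2 hx) hyx
  beta_reduce at hle
  refine lt_of_lt_of_le ?_ hle
  clear hle hmono
  have p := besselI_pos ν hν0 y hy0
  have q := besselI_pos (ν + 1) (by linarith) y hy0
  generalize besselI ν y = a at *
  generalize besselI (ν + 1) y = b at *
  have : y * (b + ν / y * a) ^ 2 + a * (b + ν / y * a) - y * a ^ 2 - (ν ^ 2 - 1 / 2) * (a ^ 2 / y)
    = y * b ^ 2 + 2 * ν * a * b + a * b + a ^ 2 * (ν + 1 / 2 - y ^ 2) / y := by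
    field_simp
    ring
  rw [this]
  have h2 : 0 < ν + 1 / 2 - y ^ 2 := by nlinarith
  positivity

theorem mul_besselI_mul_besselK_strictMonoOn (ν : ℝ) (hν : 1 / 2 ≤ ν) :
    StrictMonoOn (fun x : ℝ => x * (besselI ν x * besselK ν x)) (Set.Ioi 0) := by
  have hν0 : 0 ≤ ν := by linarith
  have hd : ∀ x, 0 < x → HasDerivAt (fun x : ℝ => x * (besselI ν x * besselK ν x))
      (1 * (besselI ν x * bM ν 0 x) + x * ((besselI (ν + 1) x + ν / x * besselI ν x) * bM ν 0 x
        + besselI ν x * (-bM ν 1 x))) x := by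
    intro x hx
    rw [bM_zero]
    exact (hasDerivAt_id x).mul ((besselI_hasDerivAt ν hν0 x hx).mul (bM_hasDerivAt ν hν0 0 x hx))
  refine strictMonoOn_of_deriv_pos (convex_Ioi 0)
    (fun x hx => (hd x hx).continuousAt.continuousWithinAt) ?_
  intro x hx
  have hx : 0 < x := by simpa using hx
  rw [(hd x hx).deriv]
  have hI := I_energy_pos ν hν x hx
  have hK := K_energy_nonpos ν hν x hx
  have pI := besselI_pos ν hν0 x hx
  have pI1 := besselI_pos (ν + 1) (by linarith) x hx
  have pK := bM_pos ν hν0 0 x hx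
  have pJ : 0 < besselI (ν + 1) x + ν / x * besselI ν x := by positivity
  generalize besselI (ν + 1) x + ν / x * besselI ν x = J at *
  generalize besselI ν x = I at *
  generalize bM ν 0 x = K at *
  generalize -bM ν 1 x = L at *
  have hm : 0 ≤ x ^ 2 + (ν ^ 2 - 1 / 4) := by nlinarith
  set c := Real.sqrt (x ^ 2 + (ν ^ 2 - 1 / 4)) with hc
  have hc0 : 0 ≤ c := Real.sqrt_nonneg _
  have hc2 : c ^ 2 = x ^ 2 + (ν ^ 2 - 1 / 4) := Real.sq_sqrt hm
  have hA : (c * I) ^ 2 < (I / 2 + x * J) ^ 2 := by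
    have := mul_pos hx hI
    have e : x * (x * J ^ 2 + I * J - x * I ^ 2 - (ν ^ 2 - 1 / 2) * (I ^ 2 / x))
      = (I / 2 + x * J) ^ 2 - c ^ 2 * I ^ 2 := by
      rw [hc2]; field_simp; ring
    rw [e] at this
    nlinarith
  have hB : (K / 2 + x * L) ^ 2 ≤ (c * K) ^ 2 := by
    have := mul_nonpos_of_nonneg_of_nonpos hx.le hK
    have e : x * (x * L ^ 2 + K * L - x * K ^ 2 - (ν ^ 2 - 1 / 2) * (K ^ 2 / x))
      = (K / 2 + x * L) ^ 2 - c ^ 2 * K ^ 2 := by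
      rw [hc2]; field_simp; ring
    rw [e] at this
    nlinarith
  have hA' : c * I < I / 2 + x * J := lt_of_pow_lt_pow_left₀ 2 (by positivity) hA
  have hB' := (abs_le_of_sq_le_sq' hB (by positivity)).1
  have h1 := mul_lt_mul_of_pos_right hA' pK
  have h2 := mul_le_mul_of_nonneg_left hB' pI.le
  nlinarith
end

section
/- For all real ν ≥ 1/2 and all x > 0, I_ν(x)·K_ν(x) < 1/(2·√((ν − 1/2)² + x²)). -/
open Real

open Set Filter Topology MeasureTheory

namespace BesselAux

lemma mono_helper {F f : ℝ → ℝ} (hF : ∀ x, 0 < x → HasDerivAt F (f x) x)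
    (hf : ∀ x, 0 < x → 0 ≤ f x) {a b : ℝ} (ha : 0 < a) (hab : a ≤ b) : F a ≤ F b := by
  have h : MonotoneOn F (Ioi 0) := by
    apply monotoneOn_of_deriv_nonneg (convex_Ioi 0)
    · intro x hx
      exact (hF x hx).continuousAt.continuousWithinAt
    · intro x hx
      rw [interior_Ioi] at hx
      exact (hF x hx).differentiableAt.differentiableWithinAt
    · intro x hx
      rw [interior_Ioi] at hx
      rw [(hF x hx).deriv]
      exact hf x hx
  exact h ha (lt_of_lt_of_le ha hab) hab

/-! ### The function K -/

noncomputable def kf (ν x t : ℝ) : ℝ := Real.exp (-x * Real.cosh t) * Real.cosh (ν * t)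

lemma kf_cont (ν x : ℝ) : Continuous (kf ν x) := by unfold kf; fun_prop

lemma kf_pos (ν x t : ℝ) : 0 < kf ν x t := mul_pos (Real.exp_pos _) (Real.cosh_pos _)

lemma cosh_mul_le (ν : ℝ) {t : ℝ} (ht : 0 ≤ t) : Real.cosh (ν * t) ≤ Real.exp (|ν| * t) := by
  rw [← Real.cosh_abs, abs_mul, abs_of_nonneg ht]
  have h : 0 ≤ |ν| * t := by positivity
  have := Real.sinh_nonneg_iff.2 h
  have h2 := Real.cosh_add_sinh (|ν| * t)
  linarith

lemma cosh_ge_half (t : ℝ) : Real.exp t / 2 ≤ Real.cosh t := by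
  rw [Real.cosh_eq]; have := Real.exp_pos (-t); linarith

lemma cosh_ge_half' (t : ℝ) : Real.exp (-t) / 2 ≤ Real.cosh t := by
  rw [Real.cosh_eq]; have := Real.exp_pos (t); linarith

lemma kf_le (ν : ℝ) {x t : ℝ} (hx : 0 < x) (ht : 0 ≤ t) :
    kf ν x t ≤ Real.exp ((|ν| + 1) ^ 2 / x) * Real.exp (-t) := by
  unfold kf
  calc _ ≤ Real.exp (-x * (t ^ 2 / 4)) * Real.exp (|ν| * t) := by
        have h1 := Real.quadratic_le_exp_of_nonneg ht
        have h2 := cosh_ge_half t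
        have h3 : t ^ 2 / 4 ≤ Real.cosh t := by nlinarith
        have h4 : -x * Real.cosh t ≤ -x * (t ^ 2 / 4) := by nlinarith
        exact mul_le_mul (Real.exp_le_exp.2 h4) (cosh_mul_le ν ht) (Real.cosh_pos _).le
          (Real.exp_pos _).le
    _ ≤ _ := by
        rw [← Real.exp_add, ← Real.exp_add, Real.exp_le_exp]
        have : (|ν| + 1) ^ 2 / x - (|ν| + 1) * t + x * (t ^ 2 / 4)
            = (|ν| + 1 - x * t / 2) ^ 2 / x := by field_simp; ring
        have h : 0 ≤ (|ν| + 1 - x * t / 2) ^ 2 / x := by positivity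
        linarith

lemma kf_int (ν : ℝ) {x : ℝ} (hx : 0 < x) : IntegrableOn (kf ν x) (Ioi 0) := by
  refine Integrable.mono' ((integrableOn_exp_neg_Ioi 0).const_mul (Real.exp ((|ν| + 1) ^ 2 / x)))
    (kf_cont ν x).aestronglyMeasurable ?_
  filter_upwards [ae_restrict_mem measurableSet_Ioi] with t ht
  rw [Real.norm_eq_abs, abs_of_pos (kf_pos ν x t)]
  exact kf_le ν hx (le_of_lt ht)

lemma besselK_eq (ν x : ℝ) : besselK ν x = ∫ t in Ioi (0 : ℝ), kf ν x t := rfl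

lemma besselK_neg (ν x : ℝ) : besselK (-ν) x = besselK ν x := by
  unfold besselK; simp

lemma besselK_nonneg (ν x : ℝ) : 0 ≤ besselK ν x :=
  integral_nonneg fun t => (kf_pos ν x t).le

lemma besselK_pos (ν : ℝ) {x : ℝ} (hx : 0 < x) : 0 < besselK ν x := by
  rw [besselK_eq, integral_pos_iff_support_of_nonneg (fun t => (kf_pos ν x t).le) (kf_int ν hx)]
  have : Function.support (kf ν x) = univ := by
    ext t; simp [(kf_pos ν x t).ne']
  rw [this]; simp

lemma besselK_mono {μ ν x : ℝ} (hx : 0 < x) (h : |μ| ≤ |ν|) : besselK μ x ≤ besselK ν x := by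
  refine integral_mono (kf_int μ hx) (kf_int ν hx) fun t => ?_
  show Real.exp (-x * Real.cosh t) * Real.cosh (μ * t) ≤
    Real.exp (-x * Real.cosh t) * Real.cosh (ν * t)
  gcongr
  rw [Real.cosh_le_cosh, abs_mul, abs_mul]
  gcongr

lemma kf_cosh (ν x t : ℝ) :
    Real.cosh t * kf ν x t = (kf (ν + 1) x t + kf (ν - 1) x t) / 2 := by
  unfold kf
  rw [show (ν + 1) * t = ν * t + t by ring, show (ν - 1) * t = ν * t - t by ring,
    Real.cosh_add, Real.cosh_sub]
  ring

lemma besselK_deriv0 (ν : ℝ) {x : ℝ} (hx : 0 < x) :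
    HasDerivAt (besselK ν) (-((besselK (ν + 1) x + besselK (ν - 1) x) / 2)) x := by
  have key := hasDerivAt_integral_of_dominated_loc_of_deriv_le
    (μ := volume.restrict (Ioi (0 : ℝ))) (F := kf ν) (x₀ := x) (s := Ioi (x / 2))
    (bound := fun t => (kf (ν + 1) (x / 2) t + kf (ν - 1) (x / 2) t) / 2)
    (F' := fun y t => -((kf (ν + 1) y t + kf (ν - 1) y t) / 2))
    (Ioi_mem_nhds (by linarith))
    (Eventually.of_forall fun y => (kf_cont ν y).aestronglyMeasurable)
    (kf_int ν hx)
    (by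
      have h1 := kf_cont (ν + 1) x
      have h2 := kf_cont (ν - 1) x
      exact (Continuous.neg ((h1.add h2).div_const 2)).aestronglyMeasurable)
    (by
      refine Eventually.of_forall fun t y hy => ?_
      rw [norm_neg, ← kf_cosh, ← kf_cosh, Real.norm_eq_abs,
        abs_of_pos (mul_pos (Real.cosh_pos _) (kf_pos _ _ _))]
      have hc := Real.cosh_pos t
      have hy' : x / 2 < y := hy
      unfold kf
      gcongr)
    (((kf_int _ (half_pos hx)).add (kf_int _ (half_pos hx))).div_const 2)
    (by
      refine Eventually.of_forall fun t y hy => ?_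
      rw [← kf_cosh]
      unfold kf
      have h : HasDerivAt (fun y : ℝ => -y * Real.cosh t) (-1 * Real.cosh t) y :=
        ((hasDerivAt_id y).neg).mul_const _
      refine ((h.exp).mul_const (Real.cosh (ν * t))).congr_deriv ?_
      ring)
  have h := key.2
  have e : ∫ t in Ioi (0 : ℝ), -((kf (ν + 1) x t + kf (ν - 1) x t) / 2)
      = -((besselK (ν + 1) x + besselK (ν - 1) x) / 2) := by
    rw [integral_neg, integral_div, integral_add (kf_int _ hx) (kf_int _ hx)]
    rfl
  rw [e] at h
  exact h

lemma besselK_rec (ν : ℝ) {x : ℝ} (hx : 0 < x) :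
    x * (besselK (ν + 1) x - besselK (ν - 1) x) = 2 * ν * besselK ν x := by
  have hI : IntegrableOn (fun t => ν * kf ν x t - x / 2 * (kf (ν + 1) x t - kf (ν - 1) x t))
      (Ioi 0) :=
    ((kf_int ν hx).const_mul ν).sub (((kf_int (ν + 1) hx).sub (kf_int (ν - 1) hx)).const_mul _)
  have h := integral_Ioi_of_hasDerivAt_of_tendsto' (a := (0 : ℝ)) (m := 0)
    (f := fun t => Real.exp (-x * Real.cosh t) * Real.sinh (ν * t))
    (f' := fun t => ν * kf ν x t - x / 2 * (kf (ν + 1) x t - kf (ν - 1) x t))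
    (by
      intro t _
      have h1 : HasDerivAt (fun t : ℝ => -x * Real.cosh t) (-x * Real.sinh t) t :=
        (Real.hasDerivAt_cosh t).const_mul _
      have h2 : HasDerivAt (fun t : ℝ => Real.sinh (ν * t)) (Real.cosh (ν * t) * (ν * 1)) t :=
        ((hasDerivAt_id t).const_mul ν).sinh
      have h3 := h1.exp.mul h2
      refine h3.congr_deriv ?_
      unfold kf
      rw [show (ν + 1) * t = ν * t + t by ring, show (ν - 1) * t = ν * t - t by ring,
        Real.cosh_add, Real.cosh_sub]
      ring)
    hI
    (by
      have hlim : Tendsto (fun t : ℝ => Real.exp ((|ν| + 1) ^ 2 / x) * Real.exp (-t)) atTop (𝓝 0) := by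
        simpa using (Real.tendsto_exp_neg_atTop_nhds_zero).const_mul (Real.exp ((|ν| + 1) ^ 2 / x))
      refine squeeze_zero_norm' ?_ hlim
      filter_upwards [eventually_ge_atTop 0] with t ht
      refine le_trans ?_ (kf_le ν hx ht)
      unfold kf
      rw [norm_mul, Real.norm_eq_abs, Real.norm_eq_abs, abs_of_pos (Real.exp_pos _)]
      gcongr
      rw [Real.abs_sinh, ← Real.cosh_abs]
      exact (Real.sinh_lt_cosh _).le)
  have hI2 : IntegrableOn (fun t => x / 2 * (kf (ν + 1) x t - kf (ν - 1) x t)) (Ioi 0) :=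
    ((kf_int (ν + 1) hx).sub (kf_int (ν - 1) hx)).const_mul _
  rw [integral_sub ((kf_int ν hx).const_mul ν) hI2, integral_const_mul,
    integral_const_mul, integral_sub (kf_int _ hx) (kf_int _ hx), ← besselK_eq, ← besselK_eq,
    ← besselK_eq] at h
  simp at h
  linarith

lemma besselK_deriv (ν : ℝ) {x : ℝ} (hx : 0 < x) :
    HasDerivAt (besselK ν) (-besselK (ν - 1) x - ν / x * besselK ν x) x := by
  convert besselK_deriv0 ν hx using 1
  have := besselK_rec ν hx
  field_simp
  linarith

lemma besselK_deriv' (ν : ℝ) {x : ℝ} (hx : 0 < x) :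
    HasDerivAt (besselK (ν - 1)) (-besselK ν x + (ν - 1) / x * besselK (ν - 1) x) x := by
  have h := besselK_deriv (1 - ν) hx
  have e : besselK (1 - ν) = besselK (ν - 1) := by
    ext y; rw [← besselK_neg]; ring_nf
  have e2 : besselK (1 - ν - 1) = besselK ν := by
    ext y; rw [← besselK_neg]; ring_nf
  rw [e, e2] at h
  convert h using 1
  ring

lemma besselK_decay (ν : ℝ) {y : ℝ} (hy : 1 ≤ y) :
    besselK ν y ≤ Real.exp (-(y - 1)) * besselK ν 1 := by
  rw [besselK_eq, besselK_eq, ← integral_const_mul]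
  refine integral_mono (kf_int ν (by linarith)) ((kf_int ν one_pos).const_mul _) fun t => ?_
  unfold kf
  dsimp only
  rw [← mul_assoc, ← Real.exp_add]
  have hc := Real.cosh_pos (ν * t)
  have := Real.one_le_cosh t
  gcongr
  nlinarith

lemma EK_nonneg {ν x : ℝ} (hν : 1 / 2 ≤ ν) (hx : 0 < x) :
    0 ≤ (2 * ν - 1) * (besselK ν x * besselK (ν - 1) x)
      - x * (besselK ν x ^ 2 - besselK (ν - 1) x ^ 2) := by
  set F : ℝ → ℝ := fun x => -(x * ((2 * ν - 1) * (besselK ν x * besselK (ν - 1) x)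
      - x * (besselK ν x ^ 2 - besselK (ν - 1) x ^ 2))) with hF
  have hm : ∀ y, 0 < y → besselK (ν - 1) y ≤ besselK ν y := fun y hy =>
    besselK_mono hy (by rw [abs_le, abs_of_nonneg (by linarith : 0 ≤ ν)]; constructor <;> linarith)
  have hd : ∀ y, 0 < y → HasDerivAt F (y * (besselK ν y ^ 2 - besselK (ν - 1) y ^ 2)) y := by
    intro y hy
    have h1 := besselK_deriv ν hy
    have h2 := besselK_deriv' ν hy
    have h := ((hasDerivAt_id y).mul (((h1.mul h2).const_mul (2 * ν - 1)).sub
      ((hasDerivAt_id y).mul ((h1.pow 2).sub (h2.pow 2))))).neg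
    refine h.congr_deriv ?_
    simp
    field_simp
    ring
  have hmono : ∀ y, x ≤ y → F x ≤ F y := fun y hxy =>
    mono_helper hd (fun y hy => mul_nonneg hy.le (by
      have := hm y hy; have := besselK_nonneg (ν - 1) y; nlinarith)) hx hxy
  have hb : ∀ᶠ y in atTop, F x ≤ (Real.exp 1 * besselK ν 1 * (y ^ 1 * Real.exp (-y))) ^ 2 := by
    filter_upwards [eventually_ge_atTop x, eventually_ge_atTop 1] with y hy hy1
    refine (hmono y hy).trans ?_
    have hy0 : 0 < y := by linarith
    have h1 := besselK_nonneg ν y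
    have h2 := besselK_nonneg (ν - 1) y
    have h3 := besselK_decay ν hy1
    have : F y ≤ (y * besselK ν y) ^ 2 := by
      simp only [hF]
      have : 0 ≤ y * ((2 * ν - 1) * (besselK ν y * besselK (ν - 1) y)) :=
        mul_nonneg hy0.le (mul_nonneg (by linarith) (mul_nonneg h1 h2))
      have := sq_nonneg (y * besselK (ν - 1) y)
      nlinarith
    refine this.trans (pow_le_pow_left₀ (mul_nonneg hy0.le h1) ?_ 2)
    calc y * besselK ν y ≤ y * (Real.exp (-(y - 1)) * besselK ν 1) := by gcongr
      _ = _ := by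
        rw [show -(y - 1) = 1 + -y by ring, Real.exp_add]; ring
  have hl : Tendsto (fun y : ℝ => (Real.exp 1 * besselK ν 1 * (y ^ 1 * Real.exp (-y))) ^ 2) atTop
      (𝓝 0) := by
    simpa using ((Real.tendsto_pow_mul_exp_neg_atTop_nhds_zero 1).const_mul
      (Real.exp 1 * besselK ν 1)).pow 2
  have h0 : F x ≤ 0 := ge_of_tendsto hl hb
  simp only [hF] at h0
  by_contra hneg
  push Not at hneg
  have := mul_neg_of_pos_of_neg hx hneg
  linarith

lemma exp_integral {ν x : ℝ} (hν : 0 < ν) (hx : 0 < x) :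
    Integrable (fun t : ℝ => Real.exp (ν * t) * Real.exp (-(x / 2) * Real.exp t)) ∧
    ∫ t : ℝ, Real.exp (ν * t) * Real.exp (-(x / 2) * Real.exp t)
      = (2 / x) ^ ν * Real.Gamma ν := by
  have himg : Real.exp '' univ = Ioi 0 := by rw [image_univ, Real.range_exp]
  have hd : ∀ t ∈ (univ : Set ℝ), HasDerivWithinAt Real.exp (Real.exp t) univ t :=
    fun t _ => (Real.hasDerivAt_exp t).hasDerivWithinAt
  have he : (fun t : ℝ => |Real.exp t| • (Real.exp t ^ (ν - 1) * Real.exp (-(x / 2 * Real.exp t))))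
      = fun t : ℝ => Real.exp (ν * t) * Real.exp (-(x / 2) * Real.exp t) := by
    ext t
    rw [abs_of_pos (Real.exp_pos t), smul_eq_mul, ← mul_assoc, ← Real.exp_mul, ← Real.exp_add]
    ring_nf
  constructor
  · have h := integrableOn_image_iff_integrableOn_abs_deriv_smul MeasurableSet.univ hd
      Real.exp_injective.injOn (fun u : ℝ => u ^ (ν - 1) * Real.exp (-(x / 2 * u)))
    rw [himg, he, integrableOn_univ] at h
    refine h.1 ?_
    have := integrableOn_rpow_mul_exp_neg_mul_rpow (p := 1) (s := ν - 1) (b := x / 2)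
      (by linarith) one_pos (by linarith)
    simpa using this
  · have h := integral_image_eq_integral_abs_deriv_smul MeasurableSet.univ hd
      Real.exp_injective.injOn (fun u : ℝ => u ^ (ν - 1) * Real.exp (-(x / 2 * u)))
    rw [himg, he, Real.integral_rpow_mul_exp_neg_mul_Ioi hν (half_pos hx)] at h
    rw [setIntegral_univ] at h
    rw [← h]; simp

lemma besselK_le_Gamma {ν x : ℝ} (hν : 0 < ν) (hx : 0 < x) :
    besselK ν x ≤ (2 / x) ^ ν * Real.Gamma ν / 2 := by
  obtain ⟨hi, he⟩ := exp_integral hν hx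
  set g : ℝ → ℝ := fun t => Real.exp (ν * t) * Real.exp (-(x / 2) * Real.exp t) with hg
  have hi2 : Integrable (fun t => g (-t)) := hi.comp_neg
  have h1 : ∫ t, g t = ∫ t in Ioi (0 : ℝ), (g t + g (-t)) := by
    rw [integral_add hi.integrableOn hi2.integrableOn, integral_comp_neg_Ioi, neg_zero,
      ← intervalIntegral.integral_Iic_add_Ioi hi.integrableOn hi.integrableOn (b := (0 : ℝ)),
      add_comm]
  rw [← he, h1, ← integral_div, besselK_eq]
  refine integral_mono (kf_int ν hx) ((hi.integrableOn.add hi2.integrableOn).div_const 2)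
    fun t => ?_
  simp only [kf, hg]
  rw [Real.cosh_eq (ν * t)]
  have a1 : Real.exp (-x * Real.cosh t) ≤ Real.exp (-(x / 2) * Real.exp t) := by
    rw [Real.exp_le_exp]; nlinarith [cosh_ge_half t]
  have a2 : Real.exp (-x * Real.cosh t) ≤ Real.exp (-(x / 2) * Real.exp (-t)) := by
    rw [Real.exp_le_exp]; nlinarith [cosh_ge_half' t]
  have b1 := mul_le_mul_of_nonneg_left a1 (Real.exp_pos (ν * t)).le
  have b2 := mul_le_mul_of_nonneg_left a2 (Real.exp_pos (-(ν * t))).le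
  rw [mul_neg]
  linarith

/-! ### The function I -/

noncomputable def cf (μ : ℝ) (k : ℕ) : ℝ := 1 / ((Nat.factorial k : ℝ) * Real.Gamma (k + μ + 1))

noncomputable def Sf (μ z : ℝ) : ℝ := ∑' k : ℕ, cf μ k * z ^ k

lemma besselI_eq (μ x : ℝ) : besselI μ x = Sf μ (x ^ 2 / 4) * (x / 2) ^ μ := by
  unfold besselI Sf
  rw [← tsum_mul_right]
  congr 1
  ext k
  rw [pow_mul, show (x / 2) ^ 2 = x ^ 2 / 4 by ring]
  unfold cf
  ring

lemma cf_pos {μ : ℝ} (hμ : -(1 / 2) ≤ μ) (k : ℕ) : 0 < cf μ k := by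
  unfold cf
  have hk : (0 : ℝ) ≤ k := Nat.cast_nonneg k
  have : 0 < Real.Gamma (k + μ + 1) := Real.Gamma_pos_of_pos (by linarith)
  positivity

lemma Gamma_lower {μ : ℝ} (hμ : -(1 / 2) ≤ μ) (k : ℕ) :
    (1 / 2) ^ k * Real.Gamma (μ + 1) ≤ Real.Gamma (k + μ + 1) := by
  induction k with
  | zero => simp
  | succ k ih =>
    have hk : (0 : ℝ) ≤ k := Nat.cast_nonneg k
    have h : Real.Gamma ((k + 1 : ℕ) + μ + 1) = (k + μ + 1) * Real.Gamma (k + μ + 1) := by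
      rw [← Real.Gamma_add_one (by linarith)]; push_cast; ring_nf
    rw [h, pow_succ]
    have := Real.Gamma_pos_of_pos (show 0 < μ + 1 by linarith)
    have h2 : (1 / 2 : ℝ) ≤ k + μ + 1 := by linarith
    calc (1 / 2 : ℝ) ^ k * (1 / 2) * Real.Gamma (μ + 1)
        = (1 / 2) * ((1 / 2 : ℝ) ^ k * Real.Gamma (μ + 1)) := by ring
      _ ≤ _ := by gcongr

lemma cf_le {μ : ℝ} (hμ : -(1 / 2) ≤ μ) (k : ℕ) {z : ℝ} (hz : 0 ≤ z) :
    cf μ k * z ^ k ≤ (1 / Real.Gamma (μ + 1)) * ((2 * z) ^ k / (Nat.factorial k : ℝ)) := by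
  unfold cf
  have h0 := Real.Gamma_pos_of_pos (show 0 < μ + 1 by linarith)
  have h := Gamma_lower hμ k
  calc 1 / ((Nat.factorial k : ℝ) * Real.Gamma (k + μ + 1)) * z ^ k
      ≤ 1 / ((Nat.factorial k : ℝ) * ((1 / 2) ^ k * Real.Gamma (μ + 1))) * z ^ k := by gcongr
    _ = _ := by
      rw [mul_pow]
      simp only [one_div, inv_pow]
      field_simp

lemma cf_summable_nonneg {μ : ℝ} (hμ : -(1 / 2) ≤ μ) {z : ℝ} (hz : 0 ≤ z) :
    Summable fun k => cf μ k * z ^ k :=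
  Summable.of_nonneg_of_le (fun k => mul_nonneg (cf_pos hμ k).le (by positivity))
    (fun k => cf_le hμ k hz) ((Real.summable_pow_div_factorial (2 * z)).mul_left _)

lemma Sf_pos {μ : ℝ} (hμ : -(1 / 2) ≤ μ) {z : ℝ} (hz : 0 ≤ z) : 0 < Sf μ z := by
  refine (cf_summable_nonneg hμ hz).tsum_pos (fun k => mul_nonneg (cf_pos hμ k).le (by positivity))
    0 ?_
  simpa using cf_pos hμ 0

lemma Sf_le {μ : ℝ} (hμ : -(1 / 2) ≤ μ) {z : ℝ} (hz : 0 ≤ z) :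
    Sf μ z ≤ 1 / Real.Gamma (μ + 1) * Real.exp (2 * z) := by
  unfold Sf
  rw [Real.exp_eq_exp_ℝ, NormedSpace.exp_eq_tsum_div, ← tsum_mul_left]
  exact (cf_summable_nonneg hμ hz).tsum_le_tsum (fun k => cf_le hμ k hz)
    ((Real.summable_pow_div_factorial (2 * z)).mul_left _)

lemma cf_succ (μ : ℝ) (k : ℕ) : cf μ (k + 1) * (k + 1) = cf (μ + 1) k := by
  unfold cf
  rw [Nat.factorial_succ]
  push_cast
  rw [show (k : ℝ) + (μ + 1) + 1 = k + 1 + μ + 1 by ring]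
  have : (k : ℝ) + 1 ≠ 0 := by positivity
  field_simp

lemma cf_rec {μ : ℝ} (hμ : 1 / 2 ≤ μ) (k : ℕ) : cf (μ - 1) k = (k + μ) * cf μ k := by
  unfold cf
  have hk : (0 : ℝ) ≤ k := Nat.cast_nonneg k
  rw [Real.Gamma_add_one (show (k : ℝ) + μ ≠ 0 by linarith),
    show (k : ℝ) + (μ - 1) + 1 = k + μ by ring]
  have h1 : (k : ℝ) + μ ≠ 0 := by linarith
  have h2 := (Real.Gamma_pos_of_pos (show 0 < (k : ℝ) + μ by linarith)).ne'
  field_simp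

lemma Sf_deriv {μ : ℝ} (hμ : -(1 / 2) ≤ μ) {z : ℝ} (hz : 0 < z) :
    HasDerivAt (Sf μ) (Sf (μ + 1) z) z := by
  have hμ' : -(1 / 2) ≤ μ + 1 := by linarith
  have hs : ∀ y : ℝ, 0 ≤ y → Summable (fun k : ℕ => cf μ k * (k * y ^ (k - 1))) := by
    intro y hy
    rw [← summable_nat_add_iff 1]
    refine (cf_summable_nonneg hμ' hy).congr fun k => ?_
    rw [← cf_succ, Nat.add_sub_cancel]; push_cast; ring
  have h := hasDerivAt_tsum_of_isPreconnected (𝕜 := ℝ) (F := ℝ) (t := Ioo 0 (2 * z))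
    (u := fun k : ℕ => cf μ k * (k * (2 * z) ^ (k - 1)))
    (g := fun k y => cf μ k * y ^ k) (g' := fun k y => cf μ k * (k * y ^ (k - 1)))
    (y₀ := z) (y := z) (hs _ (by linarith)) isOpen_Ioo isPreconnected_Ioo
    (fun k y _ => (hasDerivAt_pow k y).const_mul _)
    (by
      intro k y hy
      have h1 := hy.1
      have h2 := hy.2
      have := cf_pos hμ k
      rw [Real.norm_eq_abs, abs_of_nonneg (by positivity)]
      gcongr)
    ⟨hz, by linarith⟩ (cf_summable_nonneg hμ hz.le) ⟨hz, by linarith⟩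
  refine h.congr_deriv ?_
  rw [(hs z hz.le).tsum_eq_zero_add]
  simp only [Nat.cast_zero, zero_mul, mul_zero, zero_add]
  unfold Sf
  congr 1
  ext k
  rw [← cf_succ, Nat.add_sub_cancel]; push_cast; ring

lemma Sf_rec {μ : ℝ} (hμ : 1 / 2 ≤ μ) {z : ℝ} (hz : 0 ≤ z) :
    Sf (μ - 1) z = μ * Sf μ z + z * Sf (μ + 1) z := by
  have h1 := cf_summable_nonneg (show -(1 / 2) ≤ μ by linarith) hz
  have h2 := cf_summable_nonneg (show -(1 / 2) ≤ μ + 1 by linarith) hz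
  have e : ∀ k : ℕ, cf μ (k + 1) * (k + 1 : ℕ) * z ^ (k + 1) = z * (cf (μ + 1) k * z ^ k) := by
    intro k; rw [← cf_succ]; push_cast; ring
  have h3 : Summable fun k : ℕ => cf μ k * k * z ^ k := by
    rw [← summable_nat_add_iff 1]
    simp_rw [e]
    exact h2.mul_left z
  have e2 : z * Sf (μ + 1) z = ∑' k : ℕ, cf μ k * k * z ^ k := by
    rw [h3.tsum_eq_zero_add]
    simp_rw [e]
    rw [tsum_mul_left]; simp [Sf]
  rw [e2]
  unfold Sf
  rw [← tsum_mul_left, ← (h1.mul_left μ).tsum_add h3]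
  congr 1
  ext k
  rw [cf_rec hμ]; ring

lemma Sf_ratio {μ : ℝ} (hμ : 1 / 2 ≤ μ) {z : ℝ} (hz : 0 ≤ z) : μ * Sf μ z ≤ Sf (μ - 1) z := by
  rw [Sf_rec hμ hz]
  have := Sf_pos (show -(1 / 2) ≤ μ + 1 by linarith) hz
  nlinarith

lemma besselI_pos {μ x : ℝ} (hμ : -(1 / 2) ≤ μ) (hx : 0 < x) : 0 < besselI μ x := by
  rw [besselI_eq]
  have := Sf_pos hμ (show 0 ≤ x ^ 2 / 4 by positivity)
  positivity

lemma besselI_rec {μ x : ℝ} (hμ : 1 / 2 ≤ μ) (hx : 0 < x) :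
    besselI (μ + 1) x = besselI (μ - 1) x - 2 * μ / x * besselI μ x := by
  simp only [besselI_eq]
  rw [Sf_rec hμ (by positivity), Real.rpow_add (by positivity), Real.rpow_sub (by positivity),
    Real.rpow_one]
  field_simp
  ring

lemma besselI_ratio {μ x : ℝ} (hμ : 1 / 2 ≤ μ) (hx : 0 < x) :
    2 * μ * besselI μ x ≤ x * besselI (μ - 1) x := by
  have h := besselI_rec hμ hx
  have h2 := besselI_pos (show -(1 / 2) ≤ μ + 1 by linarith) hx
  have h3 : x * besselI (μ + 1) x = x * besselI (μ - 1) x - 2 * μ * besselI μ x := by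
    rw [h]; field_simp
  nlinarith [mul_pos hx h2]

lemma besselI_deriv {μ x : ℝ} (hμ : -(1 / 2) ≤ μ) (hx : 0 < x) :
    HasDerivAt (besselI μ) (besselI (μ + 1) x + μ / x * besselI μ x) x := by
  have hf : besselI μ = fun x => Sf μ (x ^ 2 / 4) * (x / 2) ^ μ := by
    ext y; exact besselI_eq μ y
  rw [hf]
  have h1 : HasDerivAt (fun x : ℝ => x ^ 2 / 4) (2 * x / 4) x := by
    simpa using (hasDerivAt_pow 2 x).div_const 4
  have h2 : HasDerivAt (fun x : ℝ => Sf μ (x ^ 2 / 4)) (Sf (μ + 1) (x ^ 2 / 4) * (2 * x / 4)) x :=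
    HasDerivAt.comp (h₂ := Sf μ) x (Sf_deriv hμ (show 0 < x ^ 2 / 4 by positivity)) h1
  have h3 : HasDerivAt (fun x : ℝ => (x / 2) ^ μ) (1 / 2 * μ * (x / 2) ^ (μ - 1)) x :=
    ((hasDerivAt_id x).div_const 2).rpow_const (Or.inl (by simp; positivity))
  refine (h2.mul h3).congr_deriv ?_
  simp only [besselI_eq]
  rw [Real.rpow_add (by positivity), Real.rpow_sub (by positivity), Real.rpow_one]
  field_simp
  ring

lemma besselI_deriv_a {ν x : ℝ} (hν : 1 / 2 ≤ ν) (hx : 0 < x) :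
    HasDerivAt (besselI ν) (besselI (ν - 1) x - ν / x * besselI ν x) x := by
  refine (besselI_deriv (by linarith) hx).congr_deriv ?_
  rw [besselI_rec hν hx]; ring

lemma besselI_deriv_b {ν x : ℝ} (hν : 1 / 2 ≤ ν) (hx : 0 < x) :
    HasDerivAt (besselI (ν - 1)) (besselI ν x + (ν - 1) / x * besselI (ν - 1) x) x := by
  refine (besselI_deriv (by linarith) hx).congr_deriv ?_
  rw [sub_add_cancel]

lemma G_pos {ν x : ℝ} (hν : 1 / 2 ≤ ν) (hx : 0 < x) :
    0 < x * (besselI (ν - 1) x ^ 2 - besselI ν x ^ 2) := by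
  set F : ℝ → ℝ := fun x => x * (besselI (ν - 1) x ^ 2 - besselI ν x ^ 2) with hF
  have hd : ∀ y, 0 < y →
      HasDerivAt F ((2 * ν - 1) * (besselI (ν - 1) y ^ 2 + besselI ν y ^ 2)) y := by
    intro y hy
    have h := (hasDerivAt_id y).mul (((besselI_deriv_b hν hy).pow 2).sub
      ((besselI_deriv_a hν hy).pow 2))
    refine h.congr_deriv ?_
    simp
    field_simp
    ring
  set e := min x ν with he
  have he0 : 0 < e := lt_min hx (by linarith)
  have hm : F e ≤ F x := mono_helper hd (fun y hy => mul_nonneg (by linarith) (by positivity))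
    he0 (min_le_left _ _)
  refine lt_of_lt_of_le ?_ hm
  have h1 := besselI_ratio hν he0
  have h2 := besselI_pos (show -(1 / 2) ≤ ν by linarith) he0
  have h3 := besselI_pos (show -(1 / 2) ≤ ν - 1 by linarith) he0
  have h4 : e ≤ ν := min_le_right _ _
  have h5 : besselI ν e < besselI (ν - 1) e := by
    by_contra hc
    push Not at hc
    nlinarith [mul_le_mul h4 hc h3.le (by linarith), mul_pos (show 0 < ν by linarith) h2]
  simp only [hF]
  refine mul_pos he0 ?_
  nlinarith

lemma EI_pos {ν x : ℝ} (hν : 1 / 2 ≤ ν) (hx : 0 < x) :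
    0 < x * (besselI (ν - 1) x ^ 2 - besselI ν x ^ 2)
      - (2 * ν - 1) * (besselI ν x * besselI (ν - 1) x) := by
  set F : ℝ → ℝ := fun x => x * (x * (besselI (ν - 1) x ^ 2 - besselI ν x ^ 2)
      - (2 * ν - 1) * (besselI ν x * besselI (ν - 1) x)) with hF
  have hd : ∀ y, 0 < y → HasDerivAt F (y * (besselI (ν - 1) y ^ 2 - besselI ν y ^ 2)) y := by
    intro y hy
    have h1 := besselI_deriv_a hν hy
    have h2 := besselI_deriv_b hν hy
    have h := (hasDerivAt_id y).mul (((hasDerivAt_id y).mul ((h2.pow 2).sub (h1.pow 2))).sub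
      ((h1.mul h2).const_mul (2 * ν - 1)))
    refine h.congr_deriv ?_
    simp
    field_simp
    ring
  set e := min x (1 / 2) with he
  have he0 : 0 < e := lt_min hx (by norm_num)
  have hm : F e ≤ F x := mono_helper hd (fun y hy => (G_pos hν hy).le) he0 (min_le_left _ _)
  have hpos : 0 < F e := by
    have h1 := besselI_ratio hν he0
    have h2 := besselI_pos (show -(1 / 2) ≤ ν by linarith) he0
    have h3 := besselI_pos (show -(1 / 2) ≤ ν - 1 by linarith) he0
    have h4 : e ≤ 1 / 2 := min_le_right _ _
    simp only [hF]
    refine mul_pos he0 ?_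
    generalize besselI ν e = q at *
    generalize besselI (ν - 1) e = p at *
    have a1 : (2 * ν - 1) * (q * p) ≤ e * p ^ 2 - q * p := by nlinarith
    have a2 : q ≤ e * p := by nlinarith
    have a3 : e * q < p := by nlinarith
    have a4 : e * q ^ 2 < q * p := by nlinarith
    nlinarith
  have := lt_of_lt_of_le hpos hm
  exact (pos_iff_pos_of_mul_pos this).1 hx

lemma wronskian_le {ν x : ℝ} (hν : 1 / 2 ≤ ν) (hx : 0 < x) :
    x * (besselI ν x * besselK (ν - 1) x + besselI (ν - 1) x * besselK ν x) ≤ 1 := by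
  set F : ℝ → ℝ := fun x =>
    -(x * (besselI ν x * besselK (ν - 1) x + besselI (ν - 1) x * besselK ν x)) with hF
  have hd : ∀ y, 0 < y → HasDerivAt F 0 y := by
    intro y hy
    have h1 := besselI_deriv_a hν hy
    have h2 := besselI_deriv_b hν hy
    have h3 := besselK_deriv ν hy
    have h4 := besselK_deriv' ν hy
    have h := ((hasDerivAt_id y).mul ((h1.mul h4).add (h2.mul h3))).neg
    refine h.congr_deriv ?_
    simp
    field_simp
    ring
  have hb : ∀ᶠ e in 𝓝[>] (0 : ℝ), -F x ≤ (1 + e) * Real.exp (2 * (e ^ 2 / 4)) := by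
    have hlt : ∀ᶠ e in 𝓝[>] (0 : ℝ), e < x := nhdsWithin_le_nhds (Iio_mem_nhds hx)
    filter_upwards [self_mem_nhdsWithin, hlt] with e he0 hex
    have he0 : 0 < e := he0
    have hm : F e ≤ F x := mono_helper hd (fun _ _ => le_rfl) he0 hex.le
    have h1 := besselI_ratio hν he0
    have h2 := besselI_pos (show -(1 / 2) ≤ ν by linarith) he0
    have h3 := besselI_pos (show -(1 / 2) ≤ ν - 1 by linarith) he0
    have k0 := besselK_nonneg ν e
    have k1 : besselK (ν - 1) e ≤ besselK ν e := besselK_mono he0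
      (by rw [abs_le, abs_of_nonneg (by linarith : 0 ≤ ν)]; constructor <;> linarith)
    have k2 := besselK_le_Gamma (show 0 < ν by linarith) he0
    have hq : besselI ν e ≤ e * besselI (ν - 1) e := by nlinarith
    have hA : e * (besselI (ν - 1) e * besselK ν e) ≤ Real.exp (2 * (e ^ 2 / 4)) := by
      have hS := Sf_le (show -(1 / 2) ≤ ν - 1 by linarith) (show 0 ≤ e ^ 2 / 4 by positivity)
      rw [sub_add_cancel] at hS
      have hG := Real.Gamma_pos_of_pos (show 0 < ν by linarith)
      rw [besselI_eq]
      calc e * (Sf (ν - 1) (e ^ 2 / 4) * (e / 2) ^ (ν - 1) * besselK ν e)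
          ≤ e * (1 / Real.Gamma ν * Real.exp (2 * (e ^ 2 / 4)) * (e / 2) ^ (ν - 1)
            * ((2 / e) ^ ν * Real.Gamma ν / 2)) := by gcongr
        _ = Real.exp (2 * (e ^ 2 / 4)) := by
          rw [Real.rpow_sub (by positivity), Real.rpow_one,
            show (2 / e : ℝ) = (e / 2)⁻¹ by field_simp, Real.inv_rpow (by positivity)]
          have : 0 < (e / 2) ^ ν := by positivity
          field_simp
    have hB : besselI ν e * besselK (ν - 1) e ≤ e * besselI (ν - 1) e * besselK ν e :=
      mul_le_mul hq k1 (besselK_nonneg _ _) (by positivity)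
    have : -F e ≤ (1 + e) * Real.exp (2 * (e ^ 2 / 4)) := by
      simp only [hF, neg_neg]
      have a1 := mul_le_mul_of_nonneg_left hB he0.le
      have a2 := mul_le_mul_of_nonneg_left hA (show 0 ≤ 1 + e by linarith)
      nlinarith
    linarith
  have hl : Tendsto (fun e : ℝ => (1 + e) * Real.exp (2 * (e ^ 2 / 4))) (𝓝[>] 0) (𝓝 1) := by
    have : Continuous (fun e : ℝ => (1 + e) * Real.exp (2 * (e ^ 2 / 4))) := by fun_prop
    simpa using (this.tendsto 0).mono_left nhdsWithin_le_nhds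
  have h0 := ge_of_tendsto hl hb
  simpa [hF] using h0

end BesselAux

theorem besselI_mul_besselK_upper_bound (ν x : ℝ) (hν : 1 / 2 ≤ ν) (hx : 0 < x) :
    besselI ν x * besselK ν x < 1 / (2 * Real.sqrt ((ν - 1 / 2) ^ 2 + x ^ 2)) := by
  have hEK := BesselAux.EK_nonneg hν hx
  have hEI := BesselAux.EI_pos hν hx
  have hW := BesselAux.wronskian_le hν hx
  have hq := BesselAux.besselI_pos (show -(1 / 2) ≤ ν by linarith) hx
  have hp := BesselAux.besselI_pos (show -(1 / 2) ≤ ν - 1 by linarith) hx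
  have hk := BesselAux.besselK_pos ν hx
  have hm := BesselAux.besselK_nonneg (ν - 1) x
  generalize besselI ν x = q at *
  generalize besselI (ν - 1) x = p at *
  generalize besselK ν x = k at *
  generalize besselK (ν - 1) x = m at *
  obtain ⟨a, rfl⟩ : ∃ a, ν = a + 1 / 2 := ⟨ν - 1 / 2, by ring⟩
  have ha : 0 ≤ a := by linarith
  rw [add_sub_cancel_right]
  have hs2 : Real.sqrt (a ^ 2 + x ^ 2) ^ 2 = a ^ 2 + x ^ 2 := Real.sq_sqrt (by positivity)
  have hs : 0 < Real.sqrt (a ^ 2 + x ^ 2) := by positivity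
  generalize Real.sqrt (a ^ 2 + x ^ 2) = s at *
  have has : a ≤ s := abs_le_of_sq_le_sq' (by nlinarith) hs.le |>.2
  have b1 : s * q < x * p - a * q := by
    have h1 : 0 < x * p + (s - a) * q := by
      have := mul_pos hx hp
      have := mul_nonneg (sub_nonneg.2 has) hq.le
      linarith
    have h2 : (s * q) ^ 2 < (x * p - a * q) ^ 2 := by
      rw [mul_pow, hs2]; nlinarith
    have h3 : 0 < (x * p - a * q - s * q) * (x * p + (s - a) * q) := by nlinarith
    have := (pos_iff_pos_of_mul_pos h3).2 h1
    linarith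
  have b2 : s * k ≤ x * m + a * k := by
    have h1 : 0 ≤ x * m + a * k := by positivity
    have h2 : (s * k) ^ 2 ≤ (x * m + a * k) ^ 2 := by
      rw [mul_pow, hs2]; nlinarith
    exact (abs_le_of_sq_le_sq' h2 h1).2
  rw [lt_div_iff₀ (by positivity)]
  have c1 := mul_lt_mul_of_pos_right b1 hk
  have c2 := mul_le_mul_of_nonneg_left b2 hq.le
  nlinarith
end

section
/- For all real ν ≥ 0 and all x > 0, K_{ν−1}(x)/K_ν(x) < (2g/(3x))·cos((1/3)·arccos(h/g³) − π/3) − (ν − 1/3)/x, where g = √(3(ν² + x²) + 1) and h = 9ν² − (9/2)x² − 1. -/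
open Real

open MeasureTheory Set Filter Topology in
lemma bk_bound (μ x t : ℝ) (hx : 0 < x) (ht : 0 ≤ t) :
    Real.exp (-x * Real.cosh t) * Real.cosh (μ * t) ≤
      Real.exp ((|μ| + 1) ^ 2 / x) * Real.exp (-1 * t) := by
  have h1 : t ^ 2 / 4 ≤ Real.cosh t := by
    have := Real.quadratic_le_exp_of_nonneg ht
    have h2 := Real.exp_pos (-t)
    rw [Real.cosh_eq]; nlinarith
  have h2 : Real.cosh (μ * t) ≤ Real.exp (|μ| * t) := by
    have h3 : Real.exp (μ * t) ≤ Real.exp (|μ| * t) :=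
      Real.exp_le_exp.2 (mul_le_mul_of_nonneg_right (le_abs_self μ) ht)
    have h4 : Real.exp (-(μ * t)) ≤ Real.exp (|μ| * t) :=
      Real.exp_le_exp.2 (by nlinarith [neg_abs_le μ])
    rw [Real.cosh_eq]; linarith
  calc _ ≤ Real.exp (-x * Real.cosh t) * Real.exp (|μ| * t) := by gcongr
    _ ≤ _ := by
      rw [← Real.exp_add, ← Real.exp_add]
      apply Real.exp_le_exp.2
      have h3 : x * (t ^ 2 / 4) ≤ x * Real.cosh t := by gcongr
      have h4 : (|μ| + 1) * t ≤ (|μ| + 1) ^ 2 / x + x * (t ^ 2 / 4) := by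
        have : (|μ| + 1) ^ 2 / x + x * (t ^ 2 / 4) - (|μ| + 1) * t
          = ((|μ| + 1) - x * t / 2) ^ 2 / x := by field_simp; ring
        have h5 : 0 ≤ ((|μ| + 1) - x * t / 2) ^ 2 / x := by positivity
        linarith
      linarith

open MeasureTheory Set Filter Topology in
lemma bk_int (μ x : ℝ) (hx : 0 < x) :
    IntegrableOn (fun t => Real.exp (-x * Real.cosh t) * Real.cosh (μ * t)) (Ioi 0) := by
  have h : IntegrableOn (fun t => Real.exp ((|μ| + 1) ^ 2 / x) * Real.exp (-1 * t)) (Ioi 0) :=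
    (exp_neg_integrableOn_Ioi 0 one_pos).const_mul _
  refine Integrable.mono' h ?_ ?_
  · exact (by fun_prop : Continuous fun t => Real.exp (-x * Real.cosh t) * Real.cosh (μ * t)).aestronglyMeasurable
  · refine (ae_restrict_iff' measurableSet_Ioi).2 (ae_of_all _ fun t ht => ?_)
    rw [Real.norm_of_nonneg (mul_nonneg (Real.exp_pos _).le (Real.cosh_pos _).le)]
    exact bk_bound μ x t hx (le_of_lt ht)

open MeasureTheory Set Filter Topology in
lemma bk_lower (μ x ε : ℝ) (hx : 0 < x) (hε : 0 < ε) :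
    ε * Real.exp (-x * Real.cosh ε) ≤ besselK μ x := by
  have h1 : ∫ t in Ioc 0 ε, Real.exp (-x * Real.cosh t) * Real.cosh (μ * t) ≤ besselK μ x := by
    refine setIntegral_mono_set (bk_int μ x hx) (ae_of_all _ fun t => ?_) ?_
    · exact mul_nonneg (Real.exp_pos _).le (Real.cosh_pos _).le
    · exact Ioc_subset_Ioi_self.eventuallyLE
  have h2 : ∫ t in Ioc 0 ε, Real.exp (-x * Real.cosh ε) ≤
      ∫ t in Ioc 0 ε, Real.exp (-x * Real.cosh t) * Real.cosh (μ * t) := by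
    refine setIntegral_mono_on (by simp) ((bk_int μ x hx).mono_set Ioc_subset_Ioi_self)
      measurableSet_Ioc fun t ht => ?_
    have h3 : Real.cosh t ≤ Real.cosh ε := by
      rw [Real.cosh_le_cosh, abs_of_pos ht.1, abs_of_pos hε]; exact ht.2
    have h4 : Real.exp (-x * Real.cosh ε) ≤ Real.exp (-x * Real.cosh t) := by
      apply Real.exp_le_exp.2; nlinarith
    have := Real.one_le_cosh (μ * t)
    nlinarith [Real.exp_pos (-x * Real.cosh t)]
  rw [setIntegral_const] at h2
  simp [hε.le] at h2
  simp only [neg_mul] at *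
  linarith

lemma bk_pos (μ x : ℝ) (hx : 0 < x) : 0 < besselK μ x :=
  lt_of_lt_of_le (by positivity) (bk_lower μ x 1 hx one_pos)

open MeasureTheory Set Filter Topology in
lemma bk_rec (ν x : ℝ) (hx : 0 < x) :
    x * (besselK (ν + 1) x - besselK (ν - 1) x) = 2 * ν * besselK ν x := by
  have hd : ∀ t ∈ Ici (0:ℝ), HasDerivAt (fun t => Real.exp (-x * Real.cosh t) * Real.sinh (ν * t))
      (ν * (Real.exp (-x * Real.cosh t) * Real.cosh (ν * t)) -
        x / 2 * (Real.exp (-x * Real.cosh t) * Real.cosh ((ν + 1) * t)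
         - Real.exp (-x * Real.cosh t) * Real.cosh ((ν - 1) * t))) t := by
    intro t _
    have h1 := ((Real.hasDerivAt_cosh t).const_mul (-x)).exp
    have h2 := ((hasDerivAt_id t).const_mul ν).sinh
    refine (h1.mul h2).congr_deriv ?_
    simp only [add_mul, sub_mul, one_mul, Real.cosh_add, Real.cosh_sub, id]
    ring
  have i0 := (bk_int ν x hx)
  have i1 := (bk_int (ν + 1) x hx)
  have i2 := (bk_int (ν - 1) x hx)
  have ht : Tendsto (fun t => Real.exp (-x * Real.cosh t) * Real.sinh (ν * t)) atTop (𝓝 0) := by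
    have h0 : Tendsto (fun t : ℝ => Real.exp ((|ν| + 1) ^ 2 / x) * Real.exp (-1 * t)) atTop (𝓝 0) := by
      have : Tendsto (fun t : ℝ => Real.exp (-1 * t)) atTop (𝓝 0) := by
        simpa using Real.tendsto_exp_neg_atTop_nhds_zero
      simpa using this.const_mul (Real.exp ((|ν| + 1) ^ 2 / x))
    refine squeeze_zero_norm' ?_ h0
    filter_upwards [eventually_ge_atTop 0] with t ht
    refine le_trans ?_ (bk_bound ν x t hx ht)
    rw [norm_mul, Real.norm_of_nonneg (Real.exp_pos _).le]
    gcongr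
    rw [Real.norm_eq_abs, abs_le]
    have := Real.cosh_sq (ν * t)
    constructor <;> nlinarith [Real.cosh_pos (ν * t)]
  have i3 : IntegrableOn (fun t => x / 2 * (Real.exp (-x * Real.cosh t) * Real.cosh ((ν + 1) * t)
         - Real.exp (-x * Real.cosh t) * Real.cosh ((ν - 1) * t))) (Ioi 0) :=
    (i1.sub i2).const_mul (x / 2)
  have := integral_Ioi_of_hasDerivAt_of_tendsto' hd ((i0.const_mul ν).sub i3) ht
  rw [integral_sub (i0.const_mul ν) i3, integral_const_mul,
    integral_const_mul, integral_sub i1 i2] at this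
  simp only [mul_zero, Real.sinh_zero, sub_zero] at this
  unfold besselK
  linarith

open MeasureTheory Set Filter Topology in
lemma bk_deriv (ν x : ℝ) (hx : 0 < x) :
    HasDerivAt (besselK ν) (-(besselK (ν + 1) x + besselK (ν - 1) x) / 2) x := by
  have key := hasDerivAt_integral_of_dominated_loc_of_deriv_le
    (μ := volume.restrict (Ioi (0:ℝ)))
    (F := fun x t => Real.exp (-x * Real.cosh t) * Real.cosh (ν * t))
    (F' := fun x t => -(1/2) * (Real.exp (-x * Real.cosh t) * Real.cosh ((ν + 1) * t)
         + Real.exp (-x * Real.cosh t) * Real.cosh ((ν - 1) * t)))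
    (bound := fun t => (1/2) * (Real.exp (-(x/2) * Real.cosh t) * Real.cosh ((ν + 1) * t)
         + Real.exp (-(x/2) * Real.cosh t) * Real.cosh ((ν - 1) * t)))
    (x₀ := x) (s := Ioi (x/2)) (Ioi_mem_nhds (by linarith))
    (Eventually.of_forall fun y => (by fun_prop : Continuous fun t =>
      Real.exp (-y * Real.cosh t) * Real.cosh (ν * t)).aestronglyMeasurable)
    (bk_int ν x hx)
    ((by fun_prop : Continuous fun t => -(1/2) * (Real.exp (-x * Real.cosh t) * Real.cosh ((ν + 1) * t)
         + Real.exp (-x * Real.cosh t) * Real.cosh ((ν - 1) * t))).aestronglyMeasurable)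
    (ae_of_all _ fun t y hy => by
      have h4 : Real.exp (-y * Real.cosh t) ≤ Real.exp (-(x/2) * Real.cosh t) := by
        apply Real.exp_le_exp.2; have := Real.cosh_pos t; have := mem_Ioi.1 hy; nlinarith
      have a1 := Real.cosh_pos ((ν + 1) * t)
      have a2 := Real.cosh_pos ((ν - 1) * t)
      have a3 := Real.exp_pos (-y * Real.cosh t)
      rw [norm_mul, Real.norm_of_nonneg (by positivity : 0 ≤ Real.exp (-y * Real.cosh t) * Real.cosh ((ν + 1) * t)
         + Real.exp (-y * Real.cosh t) * Real.cosh ((ν - 1) * t))]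
      have : ‖(-(1/2) : ℝ)‖ = 1/2 := by norm_num
      rw [this]
      gcongr)
    (((bk_int (ν+1) (x/2) (by linarith)).add (bk_int (ν-1) (x/2) (by linarith))).const_mul _)
    (ae_of_all _ fun t y hy => by
      have h1 := (((hasDerivAt_id y).neg.mul_const (Real.cosh t)).exp).mul_const (Real.cosh (ν * t))
      refine h1.congr_deriv ?_
      simp only [add_mul, sub_mul, one_mul, Real.cosh_add, Real.cosh_sub, id, Pi.neg_apply]
      ring)
  have h2 := key.2
  rw [integral_const_mul, integral_add (bk_int (ν+1) x hx) (bk_int (ν-1) x hx)] at h2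
  refine h2.congr_deriv ?_
  unfold besselK
  ring

/-- the logarithmic derivative `-x K'/K` -/
noncomputable def bkW (ν x : ℝ) : ℝ := x * (besselK (ν - 1) x / besselK ν x) + ν

lemma bk_deriv1 (ν x : ℝ) (hx : 0 < x) :
    HasDerivAt (besselK ν) (-(bkW ν x / x) * besselK ν x) x := by
  refine (bk_deriv ν x hx).congr_deriv ?_
  have h := bk_rec ν x hx
  have h1 := bk_pos ν x hx
  unfold bkW
  field_simp
  linarith

lemma bk_deriv2 (ν x : ℝ) (hx : 0 < x) :
    HasDerivAt (besselK (ν - 1)) (-besselK ν x + (ν - 1) / x * besselK (ν - 1) x) x := by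
  refine (bk_deriv (ν - 1) x hx).congr_deriv ?_
  have h := bk_rec (ν - 1) x hx
  simp only [sub_add_cancel] at *
  field_simp
  linarith

lemma bkW_deriv (ν x : ℝ) (hx : 0 < x) :
    HasDerivAt (bkW ν) ((bkW ν x ^ 2 - ν ^ 2 - x ^ 2) / x) x := by
  have h1 := bk_pos ν x hx
  have := ((hasDerivAt_id x).mul ((bk_deriv2 ν x hx).div (bk_deriv1 ν x hx) h1.ne')).add_const ν
  refine HasDerivAt.congr_deriv this ?_
  unfold bkW
  simp only [id, Pi.div_apply]
  field_simp
  ring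

lemma bkW_gt (ν x : ℝ) (hx : 0 < x) : ν < bkW ν x := by
  have h1 := bk_pos ν x hx
  have h2 := bk_pos (ν - 1) x hx
  unfold bkW
  have : 0 < x * (besselK (ν - 1) x / besselK ν x) := by positivity
  linarith

open Set Filter Topology in
lemma bkW_cubic (ν x₀ : ℝ) (hν : 0 ≤ ν) (hx₀ : 0 < x₀) :
    (bkW ν x₀ - 1) * (bkW ν x₀ ^ 2 - ν ^ 2) - x₀ ^ 2 * bkW ν x₀ < 0 := by
  by_contra hcon
  push Not at hcon
  have hw : ∀ x, 0 < x → 0 < bkW ν x := fun x hx => hν.trans_lt (bkW_gt ν x hx)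
  have hu : ∀ x, 0 < x → 0 < bkW ν x ^ 2 - ν ^ 2 := fun x hx => by
    have := bkW_gt ν x hx
    nlinarith
  have hP : ∀ x, x₀ ≤ x → 0 ≤ (bkW ν x - 1) * (bkW ν x ^ 2 - ν ^ 2) - x ^ 2 * bkW ν x := by
    intro b hb
    have hd : ∀ x, 0 < x → HasDerivAt
        (fun x => -((bkW ν x - 1) * (bkW ν x ^ 2 - ν ^ 2) - x ^ 2 * bkW ν x))
        (-((3 * bkW ν x ^ 2 - 2 * bkW ν x - ν ^ 2 - x ^ 2) * ((bkW ν x ^ 2 - ν ^ 2 - x ^ 2) / x)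
          - 2 * x * bkW ν x)) x := by
      intro x hx
      have h := bkW_deriv ν x hx
      have := (((h.sub_const 1).mul ((h.pow 2).sub_const (ν ^ 2))).sub
        (((hasDerivAt_id x).pow 2).mul h)).neg
      refine this.congr_deriv ?_
      simp only [id, Pi.pow_apply]
      push_cast
      ring
    have := image_le_of_deriv_right_lt_deriv_boundary' (a := x₀) (b := b)
      (f := fun x => -((bkW ν x - 1) * (bkW ν x ^ 2 - ν ^ 2) - x ^ 2 * bkW ν x))
      (B := fun _ => 0) (B' := fun _ => 0)
      (fun x hx => (hd x (hx₀.trans_le hx.1)).continuousAt.continuousWithinAt)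
      (fun x hx => (hd x (hx₀.trans_le hx.1)).hasDerivWithinAt)
      (by simpa using hcon) continuousOn_const
      (fun x hx => hasDerivWithinAt_const _ _ _)
      (by
        intro x hx h0
        have hx0 := hx₀.trans_le hx.1
        have hw0 := hw x hx0
        have hu0 := hu x hx0
        set w := bkW ν x
        set u := w ^ 2 - ν ^ 2 with hudef
        have e1 : x ^ 2 = u * (w - 1) / w := by
          field_simp; linarith
        have e2 : (3 * w ^ 2 - 2 * w - ν ^ 2 - x ^ 2) * ((u - x ^ 2) / x) - 2 * x * w
            = u ^ 2 / w ^ 2 / x := by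
          have e3 : 3 * w ^ 2 - 2 * w - ν ^ 2 - x ^ 2 = 2 * w ^ 2 - 2 * w + u / w := by
            have : u - x ^ 2 = u / w := by rw [e1]; field_simp; ring
            linarith
          have e4 : u - x ^ 2 = u / w := by rw [e1]; field_simp; ring
          have e5 : 2 * x * w = 2 * (u * (w - 1) / w) * w / x := by
            rw [← e1]; field_simp
          rw [e3, e4, e5]
          field_simp
          ring
        have e2' := e2
        rw [e2]
        have : 0 < u ^ 2 / w ^ 2 / x := by positivity
        linarith)
      (x := b) ⟨hb, le_rfl⟩
    linarith
  -- u / x^2 monotone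
  have hmono : MonotoneOn (fun x => (bkW ν x ^ 2 - ν ^ 2) / x ^ 2) (Ici x₀) := by
    have hd : ∀ x, 0 < x → HasDerivAt (fun x => (bkW ν x ^ 2 - ν ^ 2) / x ^ 2)
        (2 * (bkW ν x * (bkW ν x ^ 2 - ν ^ 2 - x ^ 2) - (bkW ν x ^ 2 - ν ^ 2)) / x ^ 3) x := by
      intro x hx
      have := ((((bkW_deriv ν x hx).pow 2).sub_const (ν ^ 2)).div ((hasDerivAt_id x).pow 2)
        (by simpa using hx.ne'))
      refine this.congr_deriv ?_
      simp only [id, Pi.pow_apply]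
      push_cast
      field_simp
    refine monotoneOn_of_deriv_nonneg (convex_Ici x₀)
      (fun x hx => (hd x (hx₀.trans_le hx)).continuousAt.continuousWithinAt)
      (fun x hx => ?_) (fun x hx => ?_)
    · rw [interior_Ici] at hx
      exact (hd x (hx₀.trans hx)).differentiableAt.differentiableWithinAt
    · rw [interior_Ici] at hx
      have hx0 : 0 < x := hx₀.trans hx
      rw [(hd x hx0).deriv]
      have := hP x (le_of_lt hx)
      apply div_nonneg _ (by positivity)
      nlinarith
  set c := (bkW ν x₀ ^ 2 - ν ^ 2) / x₀ ^ 2 with hc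
  have hc1 : 1 < c := by
    rw [hc, one_lt_div (by positivity)]
    have h1 := hw x₀ hx₀
    have h2 := hu x₀ hx₀
    by_contra h
    push Not at h
    nlinarith
  have hs1 : 1 < √c := by
    rw [Real.lt_sqrt (by norm_num)]; simpa using hc1
  have hwl : ∀ x, x₀ ≤ x → √c * x ≤ bkW ν x := by
    intro x hx
    have hx0 : 0 < x := hx₀.trans_le hx
    have h1 : c ≤ (bkW ν x ^ 2 - ν ^ 2) / x ^ 2 := hmono (mem_Ici.2 le_rfl) (mem_Ici.2 hx) hx
    rw [le_div_iff₀ (by positivity)] at h1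
    refine (sq_le_sq₀ (by positivity) (hw x hx0).le).1 ?_
    rw [mul_pow, Real.sq_sqrt (by linarith)]
    nlinarith [sq_nonneg ν]
  have hanti : AntitoneOn (fun x => besselK ν x * Real.exp (√c * x)) (Ici x₀) := by
    have hd : ∀ x, 0 < x → HasDerivAt (fun x => besselK ν x * Real.exp (√c * x))
        ((√c - bkW ν x / x) * (besselK ν x * Real.exp (√c * x))) x := by
      intro x hx
      have := (bk_deriv1 ν x hx).mul (((hasDerivAt_id x).const_mul (√c)).exp)
      refine this.congr_deriv ?_
      simp only [id]
      ring
    refine antitoneOn_of_deriv_nonpos (convex_Ici x₀)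
      (fun x hx => (hd x (hx₀.trans_le hx)).continuousAt.continuousWithinAt)
      (fun x hx => ?_) (fun x hx => ?_)
    · rw [interior_Ici] at hx
      exact (hd x (hx₀.trans hx)).differentiableAt.differentiableWithinAt
    · rw [interior_Ici] at hx
      have hx0 : 0 < x := hx₀.trans hx
      rw [(hd x hx0).deriv]
      apply mul_nonpos_of_nonpos_of_nonneg
      · have := hwl x (le_of_lt hx)
        rw [← le_div_iff₀ hx0] at this
        linarith
      · exact (mul_pos (bk_pos ν x hx0) (Real.exp_pos _)).le
  obtain ⟨ε, hε, hεc⟩ : ∃ ε : ℝ, 0 < ε ∧ Real.cosh ε < √c := by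
    have h1 : Tendsto Real.cosh (𝓝[>] 0) (𝓝 1) := by
      have := Real.continuous_cosh.tendsto 0
      rw [Real.cosh_zero] at this
      exact this.mono_left nhdsWithin_le_nhds
    have h2 := (h1.eventually (gt_mem_nhds hs1)).and self_mem_nhdsWithin
    obtain ⟨ε, h3, h4⟩ := h2.exists
    exact ⟨ε, h4, h3⟩
  have hup : ∀ x, x₀ ≤ x → ε * Real.exp ((√c - Real.cosh ε) * x) ≤
      besselK ν x₀ * Real.exp (√c * x₀) := by
    intro x hx
    refine le_trans ?_ (hanti (mem_Ici.2 le_rfl) (mem_Ici.2 hx) hx)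
    have h1 := bk_lower ν x ε (hx₀.trans_le hx) hε
    have h2 := mul_le_mul_of_nonneg_right h1 (Real.exp_pos (√c * x)).le
    refine le_trans (le_of_eq ?_) h2
    rw [mul_assoc, ← Real.exp_add]
    ring_nf
  have htend : Tendsto (fun x => ε * Real.exp ((√c - Real.cosh ε) * x)) atTop atTop :=
    (Real.tendsto_exp_atTop.comp (tendsto_id.const_mul_atTop (sub_pos.2 hεc))).const_mul_atTop hε
  obtain ⟨x, h1, h2⟩ := ((htend.eventually_gt_atTop
    (besselK ν x₀ * Real.exp (√c * x₀))).and (eventually_ge_atTop x₀)).exists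
  exact absurd (hup x h2) (not_le.2 h1)

theorem besselK_ratio_trig_upper_bound (ν x : ℝ) (hν : 0 ≤ ν) (hx : 0 < x) :
    besselK (ν - 1) x / besselK ν x <
      2 * Real.sqrt (3 * (ν ^ 2 + x ^ 2) + 1) / (3 * x) *
        Real.cos (1 / 3 * Real.arccos ((9 * ν ^ 2 - 9 / 2 * x ^ 2 - 1) /
          Real.sqrt (3 * (ν ^ 2 + x ^ 2) + 1) ^ 3) - π / 3) - (ν - 1 / 3) / x := by
  have hcub := bkW_cubic ν x hν hx
  have hrw : besselK (ν - 1) x / besselK ν x = (bkW ν x - ν) / x := by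
    unfold bkW; field_simp; ring
  rw [hrw]
  set w := bkW ν x
  set g := Real.sqrt (3 * (ν ^ 2 + x ^ 2) + 1) with hg
  have hg2 : g ^ 2 = 3 * (ν ^ 2 + x ^ 2) + 1 := Real.sq_sqrt (by positivity)
  have hg0 : 0 < g := Real.sqrt_pos.2 (by positivity)
  set h := 9 * ν ^ 2 - 9 / 2 * x ^ 2 - 1 with hh
  have hle : h ^ 2 ≤ (g ^ 3) ^ 2 := by
    have : (g ^ 3) ^ 2 = (3 * (ν ^ 2 + x ^ 2) + 1) ^ 3 := by rw [← hg2]; ring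
    rw [this, hh]
    have : (3 * (ν ^ 2 + x ^ 2) + 1) ^ 3 - (9 * ν ^ 2 - 9 / 2 * x ^ 2 - 1) ^ 2 =
      27 * ν ^ 2 * (ν ^ 2 - 1) ^ 2 + 81 * ν ^ 4 * x ^ 2 + 81 * ν ^ 2 * x ^ 4 + 27 * x ^ 6
       + 135 * ν ^ 2 * x ^ 2 + 27 / 4 * x ^ 4 := by ring
    have : 0 ≤ 27 * ν ^ 2 * (ν ^ 2 - 1) ^ 2 + 81 * ν ^ 4 * x ^ 2 + 81 * ν ^ 2 * x ^ 4 + 27 * x ^ 6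
       + 135 * ν ^ 2 * x ^ 2 + 27 / 4 * x ^ 4 := by positivity
    linarith
  have habs := abs_le_of_sq_le_sq' hle (by positivity)
  set θ := Real.arccos (h / g ^ 3) with hθ
  have hcosθ : Real.cos θ = h / g ^ 3 := by
    apply Real.cos_arccos
    · rw [le_div_iff₀ (by positivity)]; linarith [habs.1]
    · rw [div_le_iff₀ (by positivity)]; linarith [habs.2]
  set c := Real.cos (1 / 3 * θ - π / 3) with hcdef
  have hc3 : 4 * c ^ 3 - 3 * c = -(h / g ^ 3) := by
    rw [hcdef, ← Real.cos_three_mul, ← hcosθ, ← Real.cos_sub_pi]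
    congr 1; ring
  have hc12 : 1 / 2 ≤ c := by
    have h0 := Real.arccos_nonneg (h / g ^ 3)
    have h1 := Real.arccos_le_pi (h / g ^ 3)
    rw [hcdef, ← Real.cos_neg, ← Real.cos_pi_div_three]
    apply Real.cos_le_cos_of_nonneg_of_le_pi <;> linarith [Real.pi_pos]
  have hmain : w - 1 / 3 < 2 * g / 3 * c := by
    by_contra hcon
    push Not at hcon
    set y := w - 1 / 3 with hy
    set z := 2 * g / 3 * c with hz
    have hzroot : z ^ 3 - g ^ 2 / 3 * z + 2 * h / 27 = 0 := by
      have : z ^ 3 - g ^ 2 / 3 * z = 2 * g ^ 3 / 27 * (4 * c ^ 3 - 3 * c) := by rw [hz]; ring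
      rw [this, hc3]; field_simp; ring
    have hyneg : y ^ 3 - g ^ 2 / 3 * y + 2 * h / 27 < 0 := by
      rw [hg2, hh, hy]
      refine lt_of_eq_of_lt ?_ hcub
      ring
    have hz3 : g / 3 ≤ z := by rw [hz]; nlinarith
    have hfac : (y ^ 3 - g ^ 2 / 3 * y) - (z ^ 3 - g ^ 2 / 3 * z)
      = (y - z) * (y ^ 2 + y * z + z ^ 2 - g ^ 2 / 3) := by ring
    have h1 : 0 ≤ y ^ 2 + y * z + z ^ 2 - g ^ 2 / 3 := by
      have a1 : g / 3 ≤ y := hz3.trans hcon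
      nlinarith [mul_self_nonneg (y - g/3), mul_nonneg (sub_nonneg.2 a1) (sub_nonneg.2 hz3)]
    have := mul_nonneg (sub_nonneg.2 hcon) h1
    linarith
  have e : 2 * g / (3 * x) * c - (ν - 1 / 3) / x = (2 * g / 3 * c + 1 / 3 - ν) / x := by
    field_simp; ring
  rw [e]
  apply div_lt_div_of_pos_right _ hx
  linarith
end
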